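/- arXiv:2504.09276 — 2 statements merged into one kernel-verified Lean document; each statement's English description precedes it below -/
import Mathlib

section
/- Let H ∈ (0,1), let W^H be a fractional Brownian motion with Hurst parameter H, and let Y_t := ∫₀ᵗ W^H_s ds. There exists a constant c_H > 0 such that, with δ_n := c_H · 2^{−n/2} √(n log 2 + 2 log n), one has P-almost surely: limsup_{n→∞} δ_n^{−1} · sup_{0 ≤ i ≤ 2^n−1} | 2^{n(2H−3/2)} ‖ϑ̄^Y_{2n,i}‖_{ℓ₂} / √τ_H − 1 | ≤ 1. -/
open MeasureTheory ProbabilityTheory Filter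

/-- Approximated Faber–Schauder coefficient `ϑ^f_{n,k}`. -/
noncomputable def vartheta (f : ℝ → ℝ) (n k : ℕ) : ℝ :=
  (2 : ℝ) ^ ((3 * (n : ℝ)) / 2 + 3) *
    (f ((4 * k) / 2 ^ (n + 2)) - 2 * f ((4 * k + 1) / 2 ^ (n + 2))
      + 2 * f ((4 * k + 3) / 2 ^ (n + 2)) - f ((4 * k + 4) / 2 ^ (n + 2)))

/-- Squared Euclidean norm of the block `ϑ̄^f_{2n,i}`. -/
noncomputable def blockNormSq (f : ℝ → ℝ) (n i : ℕ) : ℝ :=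
  ∑ j ∈ Finset.range (2 ^ n), (vartheta f (2 * n) (2 ^ n * i + j)) ^ 2

/-- `δ_n := c_H 2^{-n/2} √(n log 2 + 2 log n)`. -/
noncomputable def deltaSeq (cH : ℝ) (n : ℕ) : ℝ :=
  cH * (2 : ℝ) ^ (-(n : ℝ) / 2) * Real.sqrt ((n : ℝ) * Real.log 2 + 2 * Real.log n)

/-- Covariance function of fractional Brownian motion with Hurst parameter `H`. -/
noncomputable def fbmCov (H s t : ℝ) : ℝ :=
  (s ^ (2 * H) + t ^ (2 * H) - |s - t| ^ (2 * H)) / 2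

/-- `W` is a fractional Brownian motion with Hurst parameter `H` on `[0,1]`:
it has a.s. continuous paths and centered Gaussian finite-dimensional distributions
with covariance `fbmCov H`. -/
def IsFBM {Ω : Type*} [MeasurableSpace Ω] (P : Measure Ω) (H : ℝ) (W : ℝ → Ω → ℝ) : Prop :=
  (∀ t, Measurable (W t)) ∧
  (∀ᵐ ω ∂P, ContinuousOn (fun t => W t ω) (Set.Icc 0 1)) ∧
  ∀ (n : ℕ) (t c : Fin n → ℝ), (∀ i, t i ∈ Set.Icc (0 : ℝ) 1) →
    Measure.map (fun ω => ∑ i, c i * W (t i) ω) P =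
      gaussianReal 0 (Real.toNNReal (∑ i, ∑ j, c i * c j * fbmCov H (t i) (t j)))

/-- Left-endpoint Riemann sum of `f` on `[a, b]` with `m` equal steps. -/
noncomputable def riemannSum (f : ℝ → ℝ) (a b : ℝ) (m : ℕ) : ℝ :=
  ∑ l ∈ Finset.range m, (b - a) / m * f (a + (b - a) / m * l)

lemma riemannSum_node_mem {a b : ℝ} (hab : a ≤ b) {m l : ℕ} (hl : l ≤ m) (hm : m ≠ 0) :
    a + (b - a) / m * l ∈ Set.Icc a b := by
  have hm' : (0 : ℝ) < m := by positivity
  have hl' : (l : ℝ) ≤ m := by exact_mod_cast hl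
  have h0 : 0 ≤ (b - a) / m := div_nonneg (by linarith) hm'.le
  refine ⟨by nlinarith [mul_nonneg h0 (Nat.cast_nonneg (α := ℝ) l)], ?_⟩
  have : (b - a) / m * l ≤ (b - a) / m * m := by gcongr
  rw [div_mul_cancel₀ _ hm'.ne'] at this
  linarith

lemma abs_riemannSum_sub_integral_le {f : ℝ → ℝ} {a b ε : ℝ} (hab : a ≤ b) {m : ℕ} (hm : m ≠ 0)
    (hf : ContinuousOn f (Set.Icc a b))
    (h : ∀ x ∈ Set.Icc a b, ∀ y ∈ Set.Icc a b, |x - y| ≤ (b - a) / m → |f x - f y| ≤ ε) :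
    |riemannSum f a b m - ∫ x in a..b, f x| ≤ ε * (b - a) := by
  have hm' : (0 : ℝ) < m := by positivity
  have h0 : 0 ≤ (b - a) / m := div_nonneg (by linarith) hm'.le
  set x : ℕ → ℝ := fun l => a + (b - a) / m * l with hx
  have hxm : x m = b := by simp only [hx]; field_simp; ring
  have hx0 : x 0 = a := by simp [hx]
  have hstep : ∀ l, x (l + 1) - x l = (b - a) / m := by intro l; simp only [hx]; push_cast; ring
  have hmem : ∀ l ≤ m, x l ∈ Set.Icc a b := fun l hl => riemannSum_node_mem hab hl hm
  have hsub : ∀ l < m, Set.Icc (x l) (x (l + 1)) ⊆ Set.Icc a b := fun l hl =>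
    Set.Icc_subset_Icc (hmem l hl.le).1 (hmem (l + 1) hl).2
  have hle : ∀ l, x l ≤ x (l + 1) := fun l => by linarith [hstep l]
  have hint : ∀ l < m, IntervalIntegrable f volume (x l) (x (l + 1)) := fun l hl =>
    (hf.mono (by rw [Set.uIcc_of_le (hle l)]; exact hsub l hl)).intervalIntegrable
  have hsum := intervalIntegral.sum_integral_adjacent_intervals (f := f) hint
  rw [hxm, hx0] at hsum
  rw [← hsum, riemannSum, ← Finset.sum_sub_distrib]
  calc _ ≤ ∑ l ∈ Finset.range m, |(b - a) / m * f (x l) - ∫ t in x l..x (l + 1), f t| :=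
        Finset.abs_sum_le_sum_abs _ _
    _ ≤ ∑ l ∈ Finset.range m, ε * ((b - a) / m) := by
        refine Finset.sum_le_sum fun l hl => ?_
        have hl := Finset.mem_range.1 hl
        have : (b - a) / m * f (x l) = ∫ t in x l..x (l + 1), f (x l) := by
          rw [intervalIntegral.integral_const, hstep, smul_eq_mul]
        rw [this, ← intervalIntegral.integral_sub intervalIntegrable_const (hint l hl),
          ← Real.norm_eq_abs]
        refine (intervalIntegral.norm_integral_le_of_norm_le_const (C := ε) fun t ht => ?_).trans ?_
        · rw [Set.uIoc_of_le (hle l)] at ht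
          refine h _ (hmem l hl.le) _ (hsub l hl (Set.Ioc_subset_Icc_self ht)) ?_
          rw [abs_sub_comm, abs_of_nonneg (by linarith [ht.1])]
          linarith [ht.2, hstep l]
        · rw [hstep, abs_of_nonneg h0]
    _ = ε * (b - a) := by
        rw [Finset.sum_const, Finset.card_range, nsmul_eq_mul]; field_simp

lemma exists_mesh_le {L δ : ℝ} (hδ : 0 < δ) :
    ∀ᶠ m : ℕ in atTop, m ≠ 0 ∧ L / m ≤ δ := by
  have : Tendsto (fun m : ℕ => L / m) atTop (nhds 0) := tendsto_const_div_atTop_nhds_zero_nat L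
  filter_upwards [this.eventually_le_const hδ, eventually_ne_atTop 0] with m h1 h2 using ⟨h2, h1⟩

lemma tendsto_riemannSum {f : ℝ → ℝ} {a b : ℝ} (hab : a ≤ b) (hf : ContinuousOn f (Set.Icc a b)) :
    Tendsto (riemannSum f a b) atTop (nhds (∫ x in a..b, f x)) := by
  have huc := isCompact_Icc.uniformContinuousOn_of_continuous hf
  rw [Metric.uniformContinuousOn_iff_le] at huc
  rw [Metric.tendsto_atTop']
  intro ε hε
  obtain ⟨δ, hδ, h⟩ := huc (ε / (b - a + 1)) (div_pos hε (by linarith))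
  obtain ⟨N, hN⟩ := eventually_atTop.1 (exists_mesh_le (L := b - a) hδ)
  refine ⟨N, fun m hm => ?_⟩
  obtain ⟨hm0, hmδ⟩ := hN m hm.le
  refine (abs_riemannSum_sub_integral_le hab hm0 hf
    fun x hx y hy hxy => h x hx y hy (hxy.trans hmδ)).trans_lt ?_
  rw [div_mul_eq_mul_div, div_lt_iff₀ (by linarith)]
  nlinarith

lemma riemannSum_mono_abs {f g : ℝ → ℝ} {a b ε : ℝ} (hab : a ≤ b) {m : ℕ} (hm : m ≠ 0)
    (h : ∀ x ∈ Set.Icc a b, |f x - g x| ≤ ε) :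
    |riemannSum f a b m - riemannSum g a b m| ≤ ε * (b - a) := by
  have hm' : (0 : ℝ) < m := by positivity
  have h0 : 0 ≤ (b - a) / m := div_nonneg (by linarith) hm'.le
  rw [riemannSum, riemannSum, ← Finset.sum_sub_distrib]
  calc _ ≤ ∑ l ∈ Finset.range m, ε * ((b - a) / m) := by
        refine (Finset.abs_sum_le_sum_abs _ _).trans (Finset.sum_le_sum fun l hl => ?_)
        rw [← mul_sub, abs_mul, abs_of_nonneg h0, mul_comm]
        exact mul_le_mul_of_nonneg_right
          (h _ (riemannSum_node_mem hab (Finset.mem_range.1 hl).le hm)) h0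
    _ = ε * (b - a) := by
        rw [Finset.sum_const, Finset.card_range, nsmul_eq_mul]; field_simp

lemma tendsto_riemannSum_riemannSum {K : ℝ → ℝ → ℝ} {a b c d : ℝ} (hab : a ≤ b) (hcd : c ≤ d)
    (hK : ContinuousOn (Function.uncurry K) (Set.Icc a b ×ˢ Set.Icc c d)) :
    Tendsto (fun m => riemannSum (fun s => riemannSum (K s) c d m) a b m) atTop
      (nhds (∫ s in a..b, ∫ t in c..d, K s t)) := by
  have huc := (isCompact_Icc.prod isCompact_Icc).uniformContinuousOn_of_continuous hK
  rw [Metric.uniformContinuousOn_iff_le] at huc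
  have hcont : ∀ s ∈ Set.Icc a b, ContinuousOn (K s) (Set.Icc c d) := fun s hs =>
    hK.comp (f := fun t => (s, t)) (by fun_prop) fun t ht => ⟨hs, ht⟩
  have hA : ∀ η > 0, ∃ δ > 0, ∀ s ∈ Set.Icc a b, ∀ s' ∈ Set.Icc a b, |s - s'| ≤ δ →
      |(∫ t in c..d, K s t) - ∫ t in c..d, K s' t| ≤ η := by
    intro η hη
    obtain ⟨δ, hδ, h⟩ := huc (η / (d - c + 1)) (div_pos hη (by linarith))
    refine ⟨δ, hδ, fun s hs s' hs' hss => ?_⟩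
    have hi : ∀ s ∈ Set.Icc a b, IntervalIntegrable (K s) volume c d := fun s hs =>
      ((hcont s hs).mono (by rw [Set.uIcc_of_le hcd])).intervalIntegrable
    rw [← intervalIntegral.integral_sub (hi s hs) (hi s' hs'), ← Real.norm_eq_abs]
    refine (intervalIntegral.norm_integral_le_of_norm_le_const
      (C := η / (d - c + 1)) fun t ht => ?_).trans ?_
    · rw [Set.uIoc_of_le hcd] at ht
      have ht := Set.Ioc_subset_Icc_self ht
      refine h (s, t) ⟨hs, ht⟩ (s', t) ⟨hs', ht⟩ ?_
      simpa [Prod.dist_eq, Real.dist_eq, hδ.le] using hss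
    · rw [abs_of_nonneg (by linarith), div_mul_eq_mul_div, div_le_iff₀ (by linarith)]
      nlinarith
  have hAc : ContinuousOn (fun s => ∫ t in c..d, K s t) (Set.Icc a b) := by
    rw [Metric.continuousOn_iff]
    intro s hs ε hε
    obtain ⟨δ, hδ, h⟩ := hA (ε / 2) (by positivity)
    refine ⟨δ, hδ, fun s' hs' hd => (h s' hs' s hs ?_).trans_lt (by linarith)⟩
    exact hd.le
  have hlim := tendsto_riemannSum hab hAc
  have hdiff : Tendsto (fun m => riemannSum (fun s => riemannSum (K s) c d m) a b m
      - riemannSum (fun s => ∫ t in c..d, K s t) a b m) atTop (nhds 0) := by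
    rw [Metric.tendsto_atTop']
    intro ε hε
    have hden : 0 < (d - c) * (b - a) + 1 :=
      add_pos_of_nonneg_of_pos (mul_nonneg (by linarith) (by linarith)) one_pos
    obtain ⟨δ, hδ, h⟩ := huc (ε / ((d - c) * (b - a) + 1)) (div_pos hε hden)
    obtain ⟨N, hN⟩ := eventually_atTop.1 (exists_mesh_le (L := d - c) hδ)
    refine ⟨N, fun m hm => ?_⟩
    obtain ⟨hm0, hmδ⟩ := hN m hm.le
    rw [Real.dist_eq, sub_zero]
    refine (riemannSum_mono_abs hab hm0 fun s hs =>
      abs_riemannSum_sub_integral_le (ε := ε / ((d - c) * (b - a) + 1)) hcd hm0 (hcont s hs)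
      fun t ht t' ht' htt => h (s, t) ⟨hs, ht⟩ (s, t') ⟨hs, ht'⟩ ?_).trans_lt ?_
    · have := htt.trans hmδ
      simpa [Prod.dist_eq, Real.dist_eq, hδ.le] using this
    · rw [mul_assoc, div_mul_eq_mul_div, div_lt_iff₀ hden]
      nlinarith
  simpa using hdiff.add hlim

lemma hasDerivAt_fwdDiff_iterate {f f' : ℝ → ℝ} (h : ∀ x > 0, HasDerivAt f (f' x) x) (k : ℕ) :
    ∀ x > 0, HasDerivAt ((fwdDiff 1)^[k] f) ((fwdDiff 1)^[k] f' x) x := by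
  induction k with
  | zero => simpa using h
  | succ k ih =>
    intro x hx
    simp only [Function.iterate_succ_apply', fwdDiff]
    exact (HasDerivAt.comp_add_const x 1 (ih (x + 1) (by linarith))).sub (ih x hx)

lemma exists_abs_fwdDiff_iterate_rpow_le (k : ℕ) : ∀ q : ℝ, q ≤ k →
    ∃ C, ∀ x > 0, |(fwdDiff 1)^[k] (fun y : ℝ => y ^ q) x| ≤ C * x ^ (q - k) := by
  induction k with
  | zero =>
    intro q _
    exact ⟨1, fun x hx => by simp [abs_of_pos (Real.rpow_pos_of_pos hx q)]⟩
  | succ k ih =>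
    intro q hq
    push_cast at hq
    obtain ⟨C, hC⟩ := ih (q - 1) (by linarith)
    refine ⟨|q| * C, fun x hx => ?_⟩
    have hd : ∀ x > 0, HasDerivAt (fun y : ℝ => y ^ q) ((q • fun y : ℝ => y ^ (q - 1)) x) x :=
      fun x hx => Real.hasDerivAt_rpow_const (Or.inl hx.ne')
    have hder := hasDerivAt_fwdDiff_iterate hd k
    obtain ⟨ξ, hξ, h⟩ := exists_hasDerivAt_eq_slope _ _ (lt_add_one x)
      (fun y hy => (hder y (by linarith [hy.1])).continuousAt.continuousWithinAt)
      (fun y hy => hder y (by linarith [hy.1]))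
    rw [Function.iterate_succ_apply', fwdDiff]
    rw [add_sub_cancel_left, div_one] at h
    rw [← h, fwdDiff_iter_const_smul, Pi.smul_apply, smul_eq_mul, abs_mul, mul_assoc]
    have hξ0 : 0 < ξ := by linarith [hξ.1]
    have hC0 : 0 ≤ C := by
      have := (abs_nonneg _).trans (hC 1 one_pos)
      simpa using this
    refine mul_le_mul_of_nonneg_left ((hC ξ hξ0).trans ?_) (abs_nonneg _)
    refine mul_le_mul_of_nonneg_left ?_ hC0
    have : q - 1 - k = q - (k + 1 : ℕ) := by push_cast; ring
    rw [this]
    exact Real.rpow_le_rpow_of_nonpos hx hξ.1.le (by push_cast; linarith)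

/-- The second primitive of `|x| ^ (2 * H)`. -/
noncomputable def absRpowPrimitive (H x : ℝ) : ℝ :=
  |x| ^ (2 * H + 2) / ((2 * H + 2) * (2 * H + 1))

lemma hasDerivAt_abs_rpow_mul_self {q : ℝ} (hq : 0 < q) (x : ℝ) :
    HasDerivAt (fun y : ℝ => |y| ^ q * y) ((q + 1) * |x| ^ q) x := by
  rcases lt_trichotomy x 0 with hx | rfl | hx
  · have h := ((hasDerivAt_neg x).rpow_const (p := q) (Or.inl (by linarith))).mul (hasDerivAt_id x)
    refine (h.congr_of_eventuallyEq ?_).congr_deriv ?_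
    · filter_upwards [eventually_lt_nhds hx] with y hy
      simp [abs_of_neg hy]
    · have : (-x) ^ q = (-x) ^ (q - 1) * (-x) := by
        rw [← Real.rpow_add_one (by linarith)]; simp
      simp only [abs_of_neg hx, id, this]
      ring
  · rw [hasDerivAt_iff_tendsto_slope, abs_zero, Real.zero_rpow hq.ne', mul_zero]
    have hc : ContinuousAt (fun y : ℝ => |y| ^ q) 0 :=
      (continuous_abs.rpow_const fun _ => Or.inr hq.le).continuousAt
    have := hc.tendsto.mono_left (nhdsWithin_le_nhds (s := {0}ᶜ))
    simp only [abs_zero, Real.zero_rpow hq.ne'] at this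
    refine this.congr' ?_
    filter_upwards [self_mem_nhdsWithin] with y hy
    have hy : y ≠ 0 := hy
    simp [slope_def_field, hy]
  · have h := ((hasDerivAt_id x).rpow_const (p := q) (Or.inl (by simpa using hx.ne'))).mul
      (hasDerivAt_id x)
    refine (h.congr_of_eventuallyEq ?_).congr_deriv ?_
    · filter_upwards [eventually_gt_nhds hx] with y hy
      simp [abs_of_pos hy]
    · have : x ^ q = x ^ (q - 1) * x := by
        rw [← Real.rpow_add_one (by linarith)]; simp
      simp only [abs_of_pos hx, id, this]
      ring

lemma integral_integral_abs_sub_rpow {H : ℝ} (hH : 0 < H) (a b c d : ℝ) :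
    ∫ s in a..b, ∫ t in c..d, |s - t| ^ (2 * H) =
      absRpowPrimitive H (b - c) - absRpowPrimitive H (a - c)
        - absRpowPrimitive H (b - d) + absRpowPrimitive H (a - d) := by
  have hq : 0 < 2 * H := by linarith
  have hcont : Continuous fun y : ℝ => |y| ^ (2 * H) :=
    continuous_abs.rpow_const fun _ => Or.inr hq.le
  have h1 : ∀ s, ∫ t in c..d, |s - t| ^ (2 * H) =
      |s - c| ^ (2 * H) * (s - c) / (2 * H + 1) - |s - d| ^ (2 * H) * (s - d) / (2 * H + 1) := by
    intro s
    have hd : ∀ t ∈ Set.uIcc c d, HasDerivAt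
        (fun t => -(|s - t| ^ (2 * H) * (s - t) / (2 * H + 1))) (|s - t| ^ (2 * H)) t := by
      intro t _
      have := (((hasDerivAt_abs_rpow_mul_self hq (s - t)).comp_const_sub s t).div_const
        (2 * H + 1)).neg
      refine this.congr_deriv ?_
      field_simp
    rw [intervalIntegral.integral_eq_sub_of_hasDerivAt hd
      ((hcont.comp (continuous_const.sub continuous_id)).intervalIntegrable c d)]
    ring
  simp_rw [h1]
  have hd : ∀ s ∈ Set.uIcc a b, HasDerivAt
      (fun s => absRpowPrimitive H (s - c) - absRpowPrimitive H (s - d))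
      (|s - c| ^ (2 * H) * (s - c) / (2 * H + 1) - |s - d| ^ (2 * H) * (s - d) / (2 * H + 1)) s := by
    have key : ∀ e s, HasDerivAt (fun s => absRpowPrimitive H (s - e))
        (|s - e| ^ (2 * H) * (s - e) / (2 * H + 1)) s := by
      intro e s
      have := ((hasDerivAt_abs_rpow (s - e) (p := 2 * H + 2) (by linarith)).comp_sub_const s e).div_const
        ((2 * H + 2) * (2 * H + 1))
      refine this.congr_deriv ?_
      rw [add_sub_cancel_right]
      field_simp
    exact fun s _ => (key c s).sub (key d s)
  rw [intervalIntegral.integral_eq_sub_of_hasDerivAt hd]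
  · ring
  · apply Continuous.intervalIntegrable
    have h2 : ∀ e, Continuous fun s : ℝ => |s - e| ^ (2 * H) := fun e => hcont.comp (by fun_prop)
    have := h2 c
    have := h2 d
    fun_prop

lemma absRpowPrimitive_neg (H x : ℝ) : absRpowPrimitive H (-x) = absRpowPrimitive H x := by
  simp [absRpowPrimitive]

/-- Autocovariance, up to the factor `2 ^ (2 - 4 * H)`, of the rescaled coefficients. -/
noncomputable def coeffAutocov (H m : ℝ) : ℝ :=
  (10 * absRpowPrimitive H (4 * m)
    - 4 * (absRpowPrimitive H (4 * m + 1) + absRpowPrimitive H (4 * m - 1))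
    - 4 * (absRpowPrimitive H (4 * m + 2) + absRpowPrimitive H (4 * m - 2))
    + 4 * (absRpowPrimitive H (4 * m + 3) + absRpowPrimitive H (4 * m - 3))
    - (absRpowPrimitive H (4 * m + 4) + absRpowPrimitive H (4 * m - 4))) / 2

lemma coeffAutocov_neg (H m : ℝ) : coeffAutocov H (-m) = coeffAutocov H m := by
  have h : ∀ c, absRpowPrimitive H (4 * -m + c) = absRpowPrimitive H (4 * m - c) := fun c => by
    rw [← absRpowPrimitive_neg]; congr 1; ring
  have h' : ∀ c, absRpowPrimitive H (4 * -m - c) = absRpowPrimitive H (4 * m + c) := fun c => by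
    rw [← absRpowPrimitive_neg]; congr 1; ring
  have h0 := h 0
  simp only [add_zero, sub_zero] at h0
  simp only [coeffAutocov, h, h', h0]
  ring

lemma strictConvexOn_const_rpow {b : ℝ} (hb : 0 < b) (hb1 : b ≠ 1) :
    StrictConvexOn ℝ Set.univ fun p : ℝ => b ^ p := by
  refine ⟨convex_univ, fun x _ y _ hxy s t hs ht hst => ?_⟩
  have hl : Real.log b ≠ 0 := Real.log_ne_zero_of_pos_of_ne_one hb hb1
  have := strictConvexOn_exp.2 (Set.mem_univ (Real.log b * x)) (Set.mem_univ (Real.log b * y))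
    (fun h => hxy (mul_left_cancel₀ hl h)) hs ht hst
  simp only [Real.rpow_def_of_pos hb, smul_eq_mul] at this ⊢
  convert this using 2
  ring

lemma four_add_four_mul_two_rpow_lt {p : ℝ} (h2 : 2 < p) (h4 : p < 4) :
    4 + 4 * (2 : ℝ) ^ p + 4 ^ p < 4 * 3 ^ p := by
  have key : ∀ b : ℝ, 0 < b → b ≠ 1 → b ^ p < (4 - p) / 2 * b ^ 2 + (p - 2) / 2 * b ^ 4 := by
    intro b hb hb1
    have := (strictConvexOn_const_rpow hb hb1).2 (Set.mem_univ 2) (Set.mem_univ 4)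
      (by norm_num) (show 0 < (4 - p) / 2 by linarith) (show 0 < (p - 2) / 2 by linarith) (by ring)
    simp only [smul_eq_mul] at this
    have e : (4 - p) / 2 * 2 + (p - 2) / 2 * 4 = p := by ring
    rw [e] at this
    exact_mod_cast this
  have h1 := key (1 / 3) (by norm_num) (by norm_num)
  have h2 := key (2 / 3) (by norm_num) (by norm_num)
  have h3 := key (4 / 3) (by norm_num) (by norm_num)
  have hpos : (0 : ℝ) < 3 ^ p := by positivity
  have : 4 * (1 / 3 : ℝ) ^ p + 4 * (2 / 3) ^ p + (4 / 3) ^ p < 4 := by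
    norm_num at h1 h2 h3 ⊢; linarith
  rw [Real.div_rpow (by norm_num) (by norm_num), Real.div_rpow (by norm_num) (by norm_num),
    Real.div_rpow (by norm_num) (by norm_num), Real.one_rpow] at this
  have e : 4 * (1 / (3 : ℝ) ^ p) + 4 * (2 ^ p / 3 ^ p) + 4 ^ p / 3 ^ p
    = (4 + 4 * 2 ^ p + 4 ^ p) / 3 ^ p := by ring
  rwa [e, div_lt_iff₀ hpos] at this

lemma coeffAutocov_zero_pos {H : ℝ} (hH : H ∈ Set.Ioo (0 : ℝ) 1) : 0 < coeffAutocov H 0 := by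
  have h := four_add_four_mul_two_rpow_lt (p := 2 * H + 2) (by linarith [hH.1]) (by linarith [hH.2])
  have hp : 0 < (2 * H + 2) * (2 * H + 1) := by nlinarith [hH.1]
  have e : coeffAutocov H 0 = (4 * 3 ^ (2 * H + 2) - (4 + 4 * (2 : ℝ) ^ (2 * H + 2)
      + 4 ^ (2 * H + 2))) / ((2 * H + 2) * (2 * H + 1)) := by
    have hne : 2 * H + 2 ≠ 0 := by linarith [hH.1]
    simp only [coeffAutocov, absRpowPrimitive]
    generalize (2 * H + 2) * (2 * H + 1) = D
    norm_num [abs_of_pos, Real.zero_rpow hne]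
    ring
  rw [e]
  exact div_pos (by linarith) hp

lemma summable_abs_coeffAutocov {H : ℝ} (hH : H ∈ Set.Ioo (0 : ℝ) 1) :
    Summable fun m : ℤ => |coeffAutocov H m| := by
  obtain ⟨C, hC⟩ := exists_abs_fwdDiff_iterate_rpow_le 6 (2 * H + 2)
    (by push_cast; linarith [hH.2])
  have hC0 : 0 ≤ C := by
    have := (abs_nonneg _).trans (hC 1 one_pos)
    simpa using this
  have hp : 0 < (2 * H + 2) * (2 * H + 1) := by nlinarith [hH.1]
  have hnat : Summable fun m : ℕ => |coeffAutocov H m| := by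
    rw [← summable_nat_add_iff 2]
    have hs : Summable fun m : ℕ => 2 * C / ((2 * H + 2) * (2 * H + 1)) * (1 / ((m : ℝ) + 1) ^ 2) := by
      have := (summable_nat_add_iff 1).2 (Real.summable_one_div_nat_pow.2 one_lt_two)
      simpa using this.mul_left (2 * C / ((2 * H + 2) * (2 * H + 1)))
    refine hs.of_nonneg_of_le (fun _ => abs_nonneg _) fun m => ?_
    set y : ℝ := 4 * m + 4 with hy
    have hy0 : 0 < y := by positivity
    have hD : ∀ z ≥ y, |(fwdDiff 1)^[6] (fun y : ℝ => y ^ (2 * H + 2)) z| ≤ C * (1 / (m + 1) ^ 2) := by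
      intro z hz
      refine (hC z (hy0.trans_le hz)).trans (mul_le_mul_of_nonneg_left ?_ hC0)
      have h1 : (1 : ℝ) ≤ m + 1 := by linarith [Nat.cast_nonneg (α := ℝ) m]
      have hz1 : (m + 1 : ℝ) ≤ z := by linarith
      calc z ^ (2 * H + 2 - (6 : ℕ)) ≤ z ^ (-2 : ℝ) :=
            Real.rpow_le_rpow_of_exponent_le (h1.trans hz1) (by push_cast; linarith [hH.2])
        _ ≤ (m + 1 : ℝ) ^ (-2 : ℝ) :=
            Real.rpow_le_rpow_of_nonpos (by positivity) hz1 (by norm_num)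
        _ = 1 / (m + 1) ^ 2 := by
            rw [Real.rpow_neg (by positivity), one_div]; norm_cast
    have e : coeffAutocov H ((m + 2 : ℕ) : ℝ) =
        -((fwdDiff 1)^[6] (fun y : ℝ => y ^ (2 * H + 2)) y
          + 2 * (fwdDiff 1)^[6] (fun y : ℝ => y ^ (2 * H + 2)) (y + 1)
          + (fwdDiff 1)^[6] (fun y : ℝ => y ^ (2 * H + 2)) (y + 2))
          / (2 * ((2 * H + 2) * (2 * H + 1))) := by
      have hG : ∀ c ≥ 0, absRpowPrimitive H (y + c) =
          (y + c) ^ (2 * H + 2) / ((2 * H + 2) * (2 * H + 1)) := fun c hc => by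
        rw [absRpowPrimitive, abs_of_nonneg (by linarith)]
      have hG0 := hG 0 le_rfl
      simp only [add_zero] at hG0
      have e0 : (4 : ℝ) * ((m + 2 : ℕ) : ℝ) = y + 4 := by push_cast; ring
      have em : ∀ c, y + 4 - c = y + (4 - c) := fun c => by ring
      simp only [coeffAutocov, e0, em, add_assoc]
      norm_num only [hG, hG0, Function.iterate_succ_apply', Function.iterate_zero, fwdDiff, id, add_assoc, add_zero]
      field_simp
      ring
    rw [e, abs_div, abs_neg, abs_of_pos (show 0 < 2 * ((2 * H + 2) * (2 * H + 1)) by positivity),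
      div_le_iff₀ (by positivity)]
    have h0 := hD y le_rfl
    have h1 := hD (y + 1) (by linarith)
    have h2 := hD (y + 2) (by linarith)
    have e2 : 2 * C / ((2 * H + 2) * (2 * H + 1)) * (1 / ((m : ℝ) + 1) ^ 2) *
      (2 * ((2 * H + 2) * (2 * H + 1))) = 4 * (C * (1 / (m + 1) ^ 2)) := by
      generalize (2 * H + 2) * (2 * H + 1) = D at hp
      field_simp
      ring
    rw [e2]
    rw [abs_le] at h0 h1 h2 ⊢
    constructor <;> linarith [h0.1, h0.2, h1.1, h1.2, h2.1, h2.2]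
  refine Summable.of_nat_of_neg (by simpa using hnat) ?_
  simpa [coeffAutocov_neg] using hnat

lemma neg_half_log_one_sub_le {y : ℝ} (hy : |y| ≤ 1 / 4) :
    -(Real.log (1 - 2 * y) / 2) ≤ y + 4 * y ^ 2 := by
  have h2 : |2 * y| ≤ 1 / 2 := by rw [abs_mul, abs_two]; linarith
  have h := Real.abs_log_sub_add_sum_range_le (x := 2 * y) (by linarith) 1
  have h3 : |2 * y| ^ (1 + 1) / (1 - |2 * y|) ≤ 2 * (2 * y) ^ 2 := by
    rw [one_add_one_eq_two, sq_abs, div_le_iff₀ (by linarith)]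
    nlinarith [sq_nonneg (2 * y)]
  have h4 := (abs_le.1 (h.trans h3)).1
  simp at h4
  nlinarith

lemma integral_exp_mul_sq_gaussianReal (v : NNReal) {r : ℝ} (hr : |r * v| ≤ 1 / 4) :
    ∫ x, Real.exp (r * x ^ 2) ∂(gaussianReal 0 v) = Real.exp (-(Real.log (1 - 2 * (r * v)) / 2)) := by
  have hpos : 0 < 1 - 2 * (r * v) := by linarith [(abs_le.1 hr).2]
  rcases eq_or_ne v 0 with rfl | hv
  · simp [gaussianReal_zero_var]
  have hv' : (0 : ℝ) < v := by positivity
  rw [integral_gaussianReal_eq_integral_smul hv]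
  have e : ∀ x : ℝ, gaussianPDFReal 0 v x • Real.exp (r * x ^ 2) =
      (Real.sqrt (2 * Real.pi * v))⁻¹ * Real.exp (-((1 - 2 * (r * v)) / (2 * v)) * x ^ 2) := by
    intro x
    rw [gaussianPDFReal, smul_eq_mul, mul_assoc, ← Real.exp_add]
    congr 2
    field_simp
    ring
  simp_rw [e]
  rw [integral_const_mul, integral_gaussian, ← Real.sqrt_inv, ← Real.sqrt_mul (by positivity),
    ← neg_div, ← Real.log_inv, ← Real.log_sqrt (by positivity), Real.exp_log (by positivity)]
  congr 1
  field_simp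

section

variable {Ω ι : Type*} [MeasurableSpace Ω] {P : Measure Ω} [Fintype ι]

lemma hasGaussianLaw_of_map_sum {X : ι → Ω → ℝ} (hX : ∀ i, AEMeasurable (X i) P)
    (h : ∀ c : ι → ℝ, ∃ v, P.map (fun ω => ∑ i, c i * X i ω) = gaussianReal 0 v) :
    HasGaussianLaw (fun ω => (X · ω)) P := by
  classical
  constructor
  refine isGaussian_of_map_eq_gaussianReal fun L => ?_
  obtain ⟨v, hv⟩ := h fun i => L (Pi.single i 1)
  refine ⟨0, v, ?_⟩
  rw [← hv, AEMeasurable.map_map_of_aemeasurable (by fun_prop) (by fun_prop)]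
  congr 1
  ext ω
  rw [Function.comp_apply, ← L.sum_comp_single]
  refine Finset.sum_congr rfl fun i _ => ?_
  have : (Pi.single i (X i ω) : ι → ℝ) = X i ω • Pi.single i 1 := by
    rw [← Pi.single_smul, smul_eq_mul, mul_one]
  simp [this, mul_comm]

/-- Jointly Gaussian variables can be rotated to independent ones. -/
lemma exists_rotation_iIndepFun [IsProbabilityMeasure P] {X : ι → Ω → ℝ}
    (hX : HasGaussianLaw (fun ω => (X · ω)) P) :
    ∃ b : OrthonormalBasis ι ℝ (EuclideanSpace ℝ ι),
      iIndepFun (fun k ω => ∑ i, b k i * X i ω) P := by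
  classical
  let A : Matrix ι ι ℝ := fun i j => cov[X i, X j; P]
  have hA : A.IsHermitian := by
    ext i j
    exact covariance_comm _ _
  refine ⟨hA.eigenvectorBasis, HasGaussianLaw.iIndepFun_of_covariance_eq_zero ?_ ?_⟩
  · let L : (ι → ℝ) →L[ℝ] (ι → ℝ) := ContinuousLinearMap.pi fun k =>
      ∑ i, hA.eigenvectorBasis k i • ContinuousLinearMap.proj i
    have h : (fun ω k => ∑ i, hA.eigenvectorBasis k i * X i ω) = fun ω => L (X · ω) := by
      ext ω k
      simp [L]
    rw [h]
    exact hX.map_fun L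
  · intro k l hkl
    have hm : ∀ k i, MemLp (fun ω => hA.eigenvectorBasis k i * X i ω) 2 P := fun k i =>
      (hX.eval i).memLp_two.const_mul _
    rw [covariance_fun_sum_fun_sum (hm k) (hm l)]
    simp_rw [covariance_const_mul_left, covariance_const_mul_right]
    have h1 : ∀ i, ∑ j, hA.eigenvectorBasis k i * (hA.eigenvectorBasis l j * cov[X i, X j; P]) =
        hA.eigenvalues l * (hA.eigenvectorBasis l i * hA.eigenvectorBasis k i) := by
      intro i
      have := congrFun (hA.mulVec_eigenvectorBasis l) i
      simp only [Matrix.mulVec, dotProduct, Pi.smul_apply, smul_eq_mul, A] at this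
      rw [← Finset.mul_sum]
      simp_rw [mul_comm (hA.eigenvectorBasis l _) (cov[_, _; P])]
      rw [this]
      ring
    simp_rw [h1]
    rw [← Finset.mul_sum]
    have ho : inner ℝ (hA.eigenvectorBasis k) (hA.eigenvectorBasis l) = 0 :=
      hA.eigenvectorBasis.orthonormal.2 hkl
    rw [PiLp.inner_apply] at ho
    simp only [RCLike.inner_apply, conj_trivial] at ho
    rw [ho, mul_zero]

lemma sum_sq_rotation (b : OrthonormalBasis ι ℝ (EuclideanSpace ℝ ι)) (x : ι → ℝ) :
    ∑ k, (∑ i, b k i * x i) ^ 2 = ∑ i, x i ^ 2 := by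
  have := b.sum_sq_norm_inner_right (WithLp.toLp 2 x)
  rw [EuclideanSpace.norm_sq_eq] at this
  simp only [Real.norm_eq_abs, sq_abs, PiLp.inner_apply, RCLike.inner_apply, conj_trivial] at this
  rw [← this]
  simp_rw [mul_comm]

lemma integral_sq_of_map_eq_gaussianReal {Z : Ω → ℝ} (hZ : AEMeasurable Z P) {v : NNReal}
    (h : P.map Z = gaussianReal 0 v) : Integrable (fun ω => Z ω ^ 2) P ∧ ∫ ω, Z ω ^ 2 ∂P = v := by
  have hm : MemLp id 2 (gaussianReal 0 v) := memLp_id_gaussianReal' 2 (by simp)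
  have h2 : Integrable (fun x : ℝ => x ^ 2) (P.map Z) := by rw [h]; exact hm.integrable_sq
  refine ⟨h2.comp_aemeasurable hZ, ?_⟩
  rw [← integral_map (f := fun x : ℝ => x ^ 2) hZ (by fun_prop), h]
  have := variance_of_integral_eq_zero (X := id) (μ := gaussianReal 0 v) aemeasurable_id
    (by simp)
  rw [variance_id_gaussianReal] at this
  simpa using this.symm

/-- Concentration of the squared norm of a centred Gaussian vector. -/
lemma measureReal_abs_sum_sq_sub_ge_le [IsProbabilityMeasure P] [Nonempty ι] {X : ι → Ω → ℝ}
    (hX : ∀ i, AEMeasurable (X i) P) {S τ : ℝ} (hτ : 0 < τ)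
    (hlaw : ∀ c : ι → ℝ, ∃ v : NNReal, (v : ℝ) ≤ S * ∑ i, c i ^ 2 ∧
      P.map (fun ω => ∑ i, c i * X i ω) = gaussianReal 0 v)
    (hvar : ∀ i, ∫ ω, X i ω ^ 2 ∂P = τ) {t : ℝ} (ht : 0 ≤ t) (ht' : t ≤ Fintype.card ι * τ) :
    P.real {ω | t ≤ |∑ i, X i ω ^ 2 - Fintype.card ι * τ|} ≤
      2 * Real.exp (-t ^ 2 / (16 * S * (Fintype.card ι * τ))) := by
  classical
  have hG := hasGaussianLaw_of_map_sum hX fun c => (hlaw c).imp fun _ h => h.2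
  obtain ⟨b, hb⟩ := exists_rotation_iIndepFun hG
  set Z : ι → Ω → ℝ := fun k ω => ∑ i, b k i * X i ω with hZ
  have hZm : ∀ k, AEMeasurable (Z k) P := fun k => by fun_prop
  choose v hvS hv using fun k => hlaw fun i => b k i
  have hvS : ∀ k, (v k : ℝ) ≤ S := fun k => by
    have h1 := b.norm_eq_one k
    have : ∑ i, b k i ^ 2 = 1 := by
      have h2 := EuclideanSpace.norm_sq_eq (b k)
      rw [h1] at h2
      simpa using h2.symm
    simpa [this] using hvS k
  set T : ℝ := Fintype.card ι * τ with hT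
  have hTpos : 0 < T := mul_pos (by exact_mod_cast Fintype.card_pos) hτ
  have hsumv : ∑ k, (v k : ℝ) = T := by
    have h1 : ∀ k, ∫ ω, Z k ω ^ 2 ∂P = v k := fun k =>
      (integral_sq_of_map_eq_gaussianReal (hZm k) (hv k)).2
    have h2 : ∀ i, Integrable (fun ω => X i ω ^ 2) P := fun i => (hG.eval i).memLp_two.integrable_sq
    simp_rw [← h1]
    rw [← integral_finsetSum _ fun k _ => (integral_sq_of_map_eq_gaussianReal (hZm k) (hv k)).1]
    simp_rw [hZ, sum_sq_rotation b]
    rw [integral_finsetSum _ fun i _ => h2 i]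
    simp [hvar, hT]
  have hS : 0 < S := by
    by_contra! h
    have : ∑ k, (v k : ℝ) ≤ 0 := Finset.sum_nonpos fun k _ => (hvS k).trans h
    linarith
  set Q : Ω → ℝ := fun ω => ∑ i, X i ω ^ 2 with hQ
  have hQZ : Q = ∑ k, fun ω => Z k ω ^ 2 := by
    ext ω
    rw [hQ, Finset.sum_apply]
    exact (sum_sq_rotation b fun i => X i ω).symm
  have hindep : iIndepFun (fun k ω => Z k ω ^ 2) P :=
    hb.comp (fun _ x => x ^ 2) fun _ => by fun_prop
  have hmgf : ∀ r : ℝ, |r| * S ≤ 1 / 4 →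
      Integrable (fun ω => Real.exp (r * Q ω)) P ∧
        mgf Q P r ≤ Real.exp (r * T + 4 * r ^ 2 * (S * T)) := by
    intro r hr
    have hrv : ∀ k, |r * v k| ≤ 1 / 4 := fun k => by
      rw [abs_mul, NNReal.abs_eq]
      exact (mul_le_mul_of_nonneg_left (hvS k) (abs_nonneg _)).trans hr
    have hmgfk : ∀ k, mgf (fun ω => Z k ω ^ 2) P r =
        Real.exp (-(Real.log (1 - 2 * (r * v k)) / 2)) := by
      intro k
      rw [← integral_exp_mul_sq_gaussianReal (v k) (hrv k), ← hv k,
        integral_map (hZm k) (by fun_prop)]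
      rfl
    have hint : Integrable (fun ω => Real.exp (r * Q ω)) P := by
      refine Integrable.of_integral_ne_zero ?_
      change mgf Q P r ≠ 0
      rw [hQZ, hindep.mgf_sum₀ (fun k => by fun_prop)]
      exact Finset.prod_ne_zero_iff.2 fun k _ => by rw [hmgfk]; exact (Real.exp_pos _).ne'
    refine ⟨hint, ?_⟩
    rw [hQZ, hindep.mgf_sum₀ (fun k => by fun_prop)]
    simp_rw [hmgfk]
    rw [← Real.exp_sum]
    refine Real.exp_le_exp.2 ?_
    calc _ ≤ ∑ k, (r * v k + 4 * r ^ 2 * (S * v k)) := by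
          refine Finset.sum_le_sum fun k _ => (neg_half_log_one_sub_le (hrv k)).trans ?_
          have : (v k : ℝ) * v k ≤ S * v k := mul_le_mul_of_nonneg_right (hvS k) (v k).2
          nlinarith [sq_nonneg r]
      _ = _ := by
          rw [Finset.sum_add_distrib, ← Finset.mul_sum, ← Finset.mul_sum, ← Finset.mul_sum, hsumv]
  set r : ℝ := t / (8 * S * T) with hr
  have hr0 : 0 ≤ r := by positivity
  have hrS : |r| * S ≤ 1 / 4 := by
    rw [abs_of_nonneg hr0, hr, div_mul_eq_mul_div, div_le_iff₀ (by positivity)]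
    nlinarith
  have hexp : -r * t + 4 * r ^ 2 * (S * T) = -t ^ 2 / (16 * S * T) := by
    rw [hr]; field_simp; ring
  have hup : P.real {ω | T + t ≤ Q ω} ≤ Real.exp (-t ^ 2 / (16 * S * T)) := by
    obtain ⟨h1, h2⟩ := hmgf r hrS
    refine (measure_ge_le_exp_mul_mgf (T + t) hr0 h1).trans
      ((mul_le_mul_of_nonneg_left h2 (Real.exp_pos _).le).trans ?_)
    rw [← Real.exp_add, ← hexp]
    exact Real.exp_le_exp.2 (by linarith)
  have hlo : P.real {ω | Q ω ≤ T - t} ≤ Real.exp (-t ^ 2 / (16 * S * T)) := by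
    obtain ⟨h1, h2⟩ := hmgf (-r) (by rwa [abs_neg])
    refine (measure_le_le_exp_mul_mgf (T - t) (by linarith) h1).trans
      ((mul_le_mul_of_nonneg_left h2 (Real.exp_pos _).le).trans ?_)
    rw [← Real.exp_add, ← hexp]
    exact Real.exp_le_exp.2 (by rw [neg_sq]; linarith)
  have hsub : {ω | t ≤ |Q ω - T|} ⊆ {ω | T + t ≤ Q ω} ∪ {ω | Q ω ≤ T - t} := by
    intro ω hω
    rcases le_abs.1 hω.out with h | h
    · left; simp only [Set.mem_ofPred_eq]; linarith
    · right; simp only [Set.mem_ofPred_eq]; linarith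
  calc _ ≤ P.real ({ω | T + t ≤ Q ω} ∪ {ω | Q ω ≤ T - t}) := measureReal_mono hsub
    _ ≤ _ := measureReal_union_le _ _
    _ ≤ _ := by linarith

end

lemma map_eq_gaussianReal_of_tendsto {Ω : Type*} [MeasurableSpace Ω] {P : Measure Ω}
    [IsProbabilityMeasure P] {Z : ℕ → Ω → ℝ} {Z' : Ω → ℝ} {v : ℕ → NNReal} {v' : NNReal}
    (hZ : ∀ m, AEMeasurable (Z m) P)
    (hlim : ∀ᵐ ω ∂P, Tendsto (fun m => Z m ω) atTop (nhds (Z' ω)))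
    (hlaw : ∀ m, P.map (Z m) = gaussianReal 0 (v m)) (hv : Tendsto v atTop (nhds v')) :
    P.map Z' = gaussianReal 0 v' := by
  have hZ' : AEMeasurable Z' P := aemeasurable_of_tendsto_metrizable_ae atTop hZ hlim
  have := Measure.isProbabilityMeasure_map (μ := P) hZ'
  refine Measure.ext_of_charFun (funext fun t => ?_)
  have hchar : ∀ Y : Ω → ℝ, AEMeasurable Y P →
      charFun (P.map Y) t = ∫ ω, Complex.exp (t * Y ω * Complex.I) ∂P := fun Y hY => by
    rw [charFun_apply_real, integral_map hY (by fun_prop)]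
  have h1 : Tendsto (fun m => charFun (P.map (Z m)) t) atTop (nhds (charFun (P.map Z') t)) := by
    rw [hchar Z' hZ']
    simp_rw [fun m => hchar (Z m) (hZ m)]
    refine tendsto_integral_of_dominated_convergence (fun _ => 1)
      (fun m => ?_) (integrable_const _) (fun m => ?_) ?_
    · have := hZ m
      exact (by fun_prop : AEMeasurable (fun ω => Complex.exp (t * Z m ω * Complex.I)) P).aestronglyMeasurable
    · refine ae_of_all _ fun ω => ?_
      rw [← Complex.ofReal_mul, Complex.norm_exp_ofReal_mul_I]
    · filter_upwards [hlim] with ω hω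
      have hc : Continuous fun x : ℝ => Complex.exp (t * x * Complex.I) := by fun_prop
      exact (hc.tendsto _).comp hω
  have h2 : Tendsto (fun m => charFun (P.map (Z m)) t) atTop
      (nhds (charFun (gaussianReal 0 v') t)) := by
    simp_rw [hlaw, charFun_gaussianReal]
    have hv2 : Tendsto (fun m => ((v m : ℝ) : ℂ)) atTop (nhds ((v' : ℝ) : ℂ)) :=
      ((Complex.continuous_ofReal.comp NNReal.continuous_coe).tendsto _).comp hv
    have hc : Continuous fun x : ℂ => Complex.exp (t * (0 : ℝ) * Complex.I - x * t ^ 2 / 2) := by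
      fun_prop
    exact (hc.tendsto _).comp hv2
  exact tendsto_nhds_unique h1 h2

lemma continuous_uncurry_fbmCov {H : ℝ} (hH : 0 < H) :
    Continuous (Function.uncurry (fbmCov H)) := by
  have hq : 0 ≤ 2 * H := by linarith
  simp only [Function.uncurry_def, fbmCov]
  have h1 : Continuous fun p : ℝ × ℝ => p.1 ^ (2 * H) :=
    continuous_fst.rpow_const fun _ => Or.inr hq
  have h2 : Continuous fun p : ℝ × ℝ => p.2 ^ (2 * H) :=
    continuous_snd.rpow_const fun _ => Or.inr hq
  have h3 : Continuous fun p : ℝ × ℝ => |p.1 - p.2| ^ (2 * H) :=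
    (continuous_fst.sub continuous_snd).abs.rpow_const fun _ => Or.inr hq
  fun_prop

section

variable {Ω : Type*} [MeasurableSpace Ω] {P : Measure Ω} {H : ℝ} {W : ℝ → Ω → ℝ}

lemma IsFBM.map_sum {κ : Type*} [Fintype κ] (hW : IsFBM P H W) (t c : κ → ℝ)
    (ht : ∀ k, t k ∈ Set.Icc (0 : ℝ) 1) :
    P.map (fun ω => ∑ k, c k * W (t k) ω) =
      gaussianReal 0 (Real.toNNReal (∑ k, ∑ l, c k * c l * fbmCov H (t k) (t l))) := by
  let e := (Fintype.equivFin κ).symm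
  have h := hW.2.2 _ (t ∘ e) (c ∘ e) fun i => ht _
  simp only [Function.comp_apply] at h
  have h1 : ∀ ω, ∑ i, c (e i) * W (t (e i)) ω = ∑ k, c k * W (t k) ω := fun ω =>
    e.sum_comp fun k => c k * W (t k) ω
  have h2 : ∑ i, ∑ j, c (e i) * c (e j) * fbmCov H (t (e i)) (t (e j)) =
      ∑ k, ∑ l, c k * c l * fbmCov H (t k) (t l) := by
    rw [← e.sum_comp]
    exact Finset.sum_congr rfl fun i _ =>
      e.sum_comp fun l => c (e i) * c l * fbmCov H (t (e i)) (t l)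
  simpa only [h1, h2] using h

lemma IsFBM.ae_tendsto_riemannSum (hW : IsFBM P H W) {a b : ℝ} (ha : 0 ≤ a) (hab : a ≤ b)
    (hb : b ≤ 1) :
    ∀ᵐ ω ∂P, Tendsto (riemannSum (fun s => W s ω) a b) atTop (nhds (∫ s in a..b, W s ω)) := by
  filter_upwards [hW.2.1] with ω hω
  exact tendsto_riemannSum hab (hω.mono (Set.Icc_subset_Icc ha hb))

lemma IsFBM.aemeasurable_integral (hW : IsFBM P H W) {a b : ℝ} (ha : 0 ≤ a) (hab : a ≤ b)
    (hb : b ≤ 1) : AEMeasurable (fun ω => ∫ s in a..b, W s ω) P := by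
  refine aemeasurable_of_tendsto_metrizable_ae atTop (fun m => ?_)
    (hW.ae_tendsto_riemannSum ha hab hb)
  have := hW.1
  unfold riemannSum
  fun_prop

/-- Integrals of fractional Brownian motion over subintervals of `[0, 1]` are jointly Gaussian. -/
lemma IsFBM.map_sum_integral [IsProbabilityMeasure P] {ι : Type*} [Fintype ι] (hH : 0 < H)
    (hW : IsFBM P H W) (a b c : ι → ℝ) (ha : ∀ i, 0 ≤ a i) (hab : ∀ i, a i ≤ b i)
    (hb : ∀ i, b i ≤ 1) :
    P.map (fun ω => ∑ i, c i * ∫ s in a i..b i, W s ω) =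
      gaussianReal 0 (Real.toNNReal (∑ i, ∑ j, c i * c j *
        ∫ s in a i..b i, ∫ t in a j..b j, fbmCov H s t)) := by
  refine map_eq_gaussianReal_of_tendsto
    (Z := fun m ω => ∑ i, c i * riemannSum (fun s => W s ω) (a i) (b i) m)
    (v := fun m => Real.toNNReal (∑ i, ∑ j, c i * c j *
      riemannSum (fun s => riemannSum (fbmCov H s) (a j) (b j) m) (a i) (b i) m)) ?_ ?_ ?_ ?_
  · intro m
    have := hW.1
    unfold riemannSum
    fun_prop
  · filter_upwards [ae_all_iff.2 fun i => hW.ae_tendsto_riemannSum (ha i) (hab i) (hb i)] with ω hω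
    exact tendsto_finsetSum _ fun i _ => (hω i).const_mul (c i)
  · intro m
    have h := hW.map_sum (κ := ι × Fin m)
      (fun k => a k.1 + (b k.1 - a k.1) / m * (k.2 : ℕ)) (fun k => c k.1 * ((b k.1 - a k.1) / m))
      fun k => by
        have hm : m ≠ 0 := by rintro rfl; exact k.2.elim0
        exact Set.Icc_subset_Icc (ha _) (hb _) (riemannSum_node_mem (hab k.1) k.2.2.le hm)
    convert h using 3
    · simp only [riemannSum, Finset.sum_range, Fintype.sum_prod_type, Finset.mul_sum, mul_assoc]
    · simp only [riemannSum, Finset.sum_range, Fintype.sum_prod_type, Finset.mul_sum]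
      refine Finset.sum_congr rfl fun i _ => ?_
      rw [Finset.sum_comm]
      refine Finset.sum_congr rfl fun l _ => Finset.sum_congr rfl fun j _ =>
        Finset.sum_congr rfl fun l' _ => by ring
  · refine (continuous_real_toNNReal.tendsto _).comp ?_
    refine tendsto_finsetSum _ fun i _ => tendsto_finsetSum _ fun j _ => ?_
    exact (tendsto_riemannSum_riemannSum (hab i) (hab j)
      (continuous_uncurry_fbmCov hH).continuousOn).const_mul _

end

/-- The signs with which the increments of `f` over quarters of a dyadic interval enter
`vartheta f`. -/
def quarterSign : Fin 4 → ℝ := ![-1, 1, 1, -1]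

lemma sum_quarterSign (g : Fin 4 → ℝ) :
    ∑ e, quarterSign e * g e = -g 0 + g 1 + g 2 - g 3 := by
  simp [Fin.sum_univ_four, quarterSign]
  ring

lemma vartheta_integral {f : ℝ → ℝ} (hf : ContinuousOn f (Set.Icc 0 1)) {N k : ℕ}
    (hk : k < 2 ^ N) :
    vartheta (fun t => ∫ s in (0 : ℝ)..t, f s) N k =
      2 ^ (3 * (N : ℝ) / 2 + 3) * ∑ e : Fin 4, quarterSign e *
        ∫ s in ((4 * k + e : ℝ) / 2 ^ (N + 2))..((4 * k + e + 1 : ℝ) / 2 ^ (N + 2)), f s := by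
  have hM : (0 : ℝ) < 2 ^ (N + 2) := by positivity
  have hk' : (4 * k + 4 : ℝ) ≤ 2 ^ (N + 2) := by
    rw [pow_add]
    have : ((k + 1 : ℕ) : ℝ) ≤ 2 ^ N := by exact_mod_cast hk
    push_cast at this
    linarith
  have hi : ∀ a : ℝ, 0 ≤ a → a ≤ 4 → IntervalIntegrable f volume 0 ((4 * k + a) / 2 ^ (N + 2)) := by
    intro a ha ha4
    have h0 : 0 ≤ (4 * k + a) / 2 ^ (N + 2) := by positivity
    refine (hf.mono ?_).intervalIntegrable
    rw [Set.uIcc_of_le h0]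
    exact Set.Icc_subset_Icc_right ((div_le_one hM).2 (by linarith))
  have hd : ∀ a b : ℝ, 0 ≤ a → a ≤ 4 → 0 ≤ b → b ≤ 4 →
      ∫ s in ((4 * k + a) / 2 ^ (N + 2))..((4 * k + b) / 2 ^ (N + 2)), f s =
        (∫ s in (0 : ℝ)..((4 * k + b) / 2 ^ (N + 2)), f s) -
          ∫ s in (0 : ℝ)..((4 * k + a) / 2 ^ (N + 2)), f s := fun a b h1 h2 h3 h4 =>
    (intervalIntegral.integral_interval_sub_left (hi b h3 h4) (hi a h1 h2)).symm
  have h0 := hd 0 1 (by norm_num) (by norm_num) (by norm_num) (by norm_num)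
  have h1 := hd 1 2 (by norm_num) (by norm_num) (by norm_num) (by norm_num)
  have h2 := hd 2 3 (by norm_num) (by norm_num) (by norm_num) (by norm_num)
  have h3 := hd 3 4 (by norm_num) (by norm_num) (by norm_num) (by norm_num)
  rw [vartheta]
  congr 1
  simp only [sum_quarterSign, add_assoc, Fin.val_zero, Fin.val_one, Fin.val_two,
    Nat.cast_zero, Nat.cast_one, Nat.cast_ofNat, show ((3 : Fin 4) : ℕ) = 3 from rfl]
  norm_num [add_assoc] at h0 h1 h2 h3 ⊢
  rw [h0, h1, h2, h3]
  ring

lemma absRpowPrimitive_div {H M : ℝ} (hM : 0 < M) (x : ℝ) :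
    absRpowPrimitive H (x / M) = M ^ (-(2 * H + 2)) * absRpowPrimitive H x := by
  rw [absRpowPrimitive, absRpowPrimitive, abs_div, abs_of_pos hM,
    Real.div_rpow (abs_nonneg x) hM.le, Real.rpow_neg hM.le]
  ring

lemma integral_integral_fbmCov {H M : ℝ} (hH : 0 < H) (hM : 0 < M) (a b : ℝ) :
    ∫ s in (a / M)..((a + 1) / M), ∫ t in (b / M)..((b + 1) / M), fbmCov H s t =
      (∫ s in (a / M)..((a + 1) / M), s ^ (2 * H)) / (2 * M) +
        (∫ s in (b / M)..((b + 1) / M), s ^ (2 * H)) / (2 * M) -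
        M ^ (-(2 * H + 2)) * (absRpowPrimitive H (a - b + 1) - 2 * absRpowPrimitive H (a - b)
          + absRpowPrimitive H (a - b - 1)) / 2 := by
  have hq : 0 ≤ 2 * H := by linarith
  have h1 : Continuous fun s : ℝ => s ^ (2 * H) := continuous_id.rpow_const fun _ => Or.inr hq
  have h2 : Continuous fun p : ℝ × ℝ => |p.1 - p.2| ^ (2 * H) :=
    (continuous_fst.sub continuous_snd).abs.rpow_const fun _ => Or.inr hq
  have h3 : ∀ s : ℝ, Continuous fun t : ℝ => |s - t| ^ (2 * H) := fun s =>
    h2.comp (by fun_prop : Continuous fun t : ℝ => (s, t))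
  have h4 : Continuous fun s : ℝ => ∫ t in (b / M)..((b + 1) / M), |s - t| ^ (2 * H) :=
    intervalIntegral.continuous_parametric_intervalIntegral_of_continuous' h2 _ _
  have hlen : ∀ x : ℝ, (x + 1) / M - x / M = 1 / M := fun x => by ring
  have hinner : ∀ s : ℝ, ∫ t in (b / M)..((b + 1) / M), fbmCov H s t =
      (s ^ (2 * H) * (1 / M) + (∫ t in (b / M)..((b + 1) / M), t ^ (2 * H))
        - ∫ t in (b / M)..((b + 1) / M), |s - t| ^ (2 * H)) / 2 := fun s => by
    simp only [fbmCov]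
    rw [intervalIntegral.integral_div, intervalIntegral.integral_sub
      ((by fun_prop : Continuous fun t : ℝ => s ^ (2 * H) + t ^ (2 * H)).intervalIntegrable _ _)
      ((h3 s).intervalIntegrable _ _),
      intervalIntegral.integral_add (continuous_const.intervalIntegrable _ _)
      (h1.intervalIntegrable _ _), intervalIntegral.integral_const, hlen, smul_eq_mul, mul_comm]
  simp only [hinner]
  have h5 : Continuous fun s : ℝ => s ^ (2 * H) * (1 / M) := h1.mul continuous_const
  rw [intervalIntegral.integral_div, intervalIntegral.integral_sub
      ((by fun_prop : Continuous fun s : ℝ => s ^ (2 * H) * (1 / M) + _).intervalIntegrable _ _)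
      (h4.intervalIntegrable _ _),
      intervalIntegral.integral_add (h5.intervalIntegrable _ _)
      (continuous_const.intervalIntegrable _ _), intervalIntegral.integral_const, hlen, smul_eq_mul,
      intervalIntegral.integral_mul_const, integral_integral_abs_sub_rpow hH]
  simp only [← sub_div, absRpowPrimitive_div hM]
  rw [show a + 1 - b = a - b + 1 by ring, show a + 1 - (b + 1) = a - b by ring,
    show a - (b + 1) = a - b - 1 by ring]
  field_simp
  ring

lemma sum_quarterSign_integral_fbmCov {H M : ℝ} (hH : 0 < H) (hM : 0 < M) (k l : ℝ) :
    ∑ e : Fin 4, ∑ e' : Fin 4, quarterSign e * quarterSign e' *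
      ∫ s in ((4 * k + e) / M)..((4 * k + e + 1) / M),
        ∫ t in ((4 * l + e') / M)..((4 * l + e' + 1) / M), fbmCov H s t =
      M ^ (-(2 * H + 2)) * coeffAutocov H (k - l) := by
  simp only [integral_integral_fbmCov hH hM, coeffAutocov]
  simp only [Fin.sum_univ_four, quarterSign, Fin.val_zero, Fin.val_one, Fin.val_two,
    Nat.cast_zero, Nat.cast_one, Nat.cast_ofNat, show ((3 : Fin 4) : ℕ) = 3 from rfl]
  simp
  ring_nf

section

variable {Ω : Type*} [MeasurableSpace Ω] {P : Measure Ω} {H : ℝ} {W : ℝ → Ω → ℝ}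

lemma IsFBM.aemeasurable_vartheta (hW : IsFBM P H W) {N k : ℕ} (hk : k < 2 ^ N) :
    AEMeasurable (fun ω => vartheta (fun t => ∫ s in (0 : ℝ)..t, W s ω) N k) P := by
  have hk' : (4 * k + 4 : ℝ) ≤ 2 ^ (N + 2) := by
    rw [pow_add]
    have : ((k + 1 : ℕ) : ℝ) ≤ 2 ^ N := by exact_mod_cast hk
    push_cast at this
    linarith
  have h : ∀ x : ℝ, 0 ≤ x → x ≤ 4 * k + 4 →
      AEMeasurable (fun ω => ∫ s in (0 : ℝ)..(x / 2 ^ (N + 2)), W s ω) P := fun x hx hx' =>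
    hW.aemeasurable_integral le_rfl (by positivity)
      ((div_le_one (by positivity)).2 (hx'.trans hk'))
  have h0 := h (4 * k) (by positivity) (by linarith)
  have h1 := h (4 * k + 1) (by positivity) (by linarith)
  have h3 := h (4 * k + 3) (by positivity) (by linarith)
  have h4 := h (4 * k + 4) (by positivity) (by linarith)
  unfold vartheta
  exact ((((h0.sub (h1.const_mul 2)).add (h3.const_mul 2)).sub h4).const_mul _)

/-- The coefficients of the integral of fractional Brownian motion at a given level form a
stationary Gaussian vector. -/
lemma IsFBM.map_sum_vartheta [IsProbabilityMeasure P] {ι : Type*} [Fintype ι] (hH : 0 < H)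
    (hW : IsFBM P H W) {N : ℕ} {k : ι → ℕ} (hk : ∀ i, k i < 2 ^ N) (c : ι → ℝ) :
    P.map (fun ω => ∑ i, c i * vartheta (fun t => ∫ s in (0 : ℝ)..t, W s ω) N (k i)) =
      gaussianReal 0 (Real.toNNReal (∑ i, ∑ j, c i * c j *
        (2 ^ ((N : ℝ) * (1 - 2 * H)) * (2 ^ (2 - 4 * H) * coeffAutocov H (k i - k j))))) := by
  set A : ℝ := 2 ^ (3 * (N : ℝ) / 2 + 3) with hA
  set M : ℝ := 2 ^ (N + 2) with hM
  have hM0 : 0 < M := by positivity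
  have hk' : ∀ i, (4 * k i + 4 : ℝ) ≤ M := fun i => by
    rw [hM, pow_add]
    have : ((k i + 1 : ℕ) : ℝ) ≤ 2 ^ N := by exact_mod_cast hk i
    push_cast at this
    linarith
  have he : ∀ e : Fin 4, ((e : ℕ) : ℝ) + 1 ≤ 4 := fun e => by
    exact_mod_cast Nat.succ_le_of_lt e.2
  have hAM : A * A * M ^ (-(2 * H + 2)) = 2 ^ ((N : ℝ) * (1 - 2 * H)) * 2 ^ (2 - 4 * H) := by
    rw [hA, hM, ← Real.rpow_natCast 2 (N + 2), ← Real.rpow_mul two_pos.le,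
      ← Real.rpow_add two_pos, ← Real.rpow_add two_pos, ← Real.rpow_add two_pos]
    congr 1
    push_cast
    ring
  have h := hW.map_sum_integral (ι := ι × Fin 4) hH (fun p => (4 * k p.1 + p.2) / M)
    (fun p => (4 * k p.1 + p.2 + 1) / M) (fun p => c p.1 * A * quarterSign p.2)
    (fun p => by positivity) (fun p => div_le_div_of_nonneg_right (by linarith) hM0.le)
    (fun p => (div_le_one hM0).2 (by linarith [hk' p.1, he p.2]))
  refine (Measure.map_congr ?_).trans (h.trans ?_)
  · filter_upwards [hW.2.1] with ω hω
    simp only [fun i => vartheta_integral hω (hk i), Fintype.sum_prod_type, Finset.mul_sum]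
    refine Finset.sum_congr rfl fun i _ => Finset.sum_congr rfl fun e _ => by
      rw [← hA, ← hM]; ring
  · congr 2
    simp only [Fintype.sum_prod_type]
    symm
    refine Finset.sum_congr rfl fun i _ => ?_
    rw [Finset.sum_comm]
    refine Finset.sum_congr rfl fun j _ => ?_
    rw [← mul_assoc ((2 : ℝ) ^ _), ← hAM, mul_assoc (A * A),
      ← sum_quarterSign_integral_fbmCov hH hM0]
    simp only [Finset.mul_sum]
    refine Finset.sum_congr rfl fun e _ => Finset.sum_congr rfl fun e' _ => by ring

end

/-- A Schur bound for Toeplitz quadratic forms. -/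
lemma sum_sum_mul_mul_sub_le {ι : Type*} [Fintype ι] {r : ℤ → ℝ} (hr : Summable fun m => |r m|)
    {k : ι → ℤ} (hk : Function.Injective k) (c : ι → ℝ) :
    ∑ i, ∑ j, c i * c j * r (k i - k j) ≤ (∑' m, |r m|) * ∑ i, c i ^ 2 := by
  have hrow : ∀ i, ∑ j, |r (k i - k j)| ≤ ∑' m, |r m| := fun i => by
    rw [← tsum_fintype (L := SummationFilter.unconditional _)]
    exact tsum_comp_le_tsum_of_inj hr (fun _ => abs_nonneg _)
      (i := fun j => k i - k j) fun a b h => hk (by simpa using h)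
  have hcol : ∀ j, ∑ i, |r (k i - k j)| ≤ ∑' m, |r m| := fun j => by
    rw [← tsum_fintype (L := SummationFilter.unconditional _)]
    exact tsum_comp_le_tsum_of_inj hr (fun _ => abs_nonneg _)
      (i := fun i => k i - k j) fun a b h => hk (by simpa using h)
  have hterm : ∀ i j, c i * c j * r (k i - k j) ≤
      c i ^ 2 / 2 * |r (k i - k j)| + c j ^ 2 / 2 * |r (k i - k j)| := fun i j => by
    have h1 : |c i * c j| ≤ c i ^ 2 / 2 + c j ^ 2 / 2 := by
      rw [abs_le]
      constructor <;> nlinarith [sq_nonneg (c i + c j), sq_nonneg (c i - c j)]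
    calc c i * c j * r (k i - k j) ≤ |c i * c j| * |r (k i - k j)| := by
          rw [← abs_mul]; exact le_abs_self _
      _ ≤ _ := by rw [← add_mul]; gcongr
  calc ∑ i, ∑ j, c i * c j * r (k i - k j)
      ≤ ∑ i, ∑ j, (c i ^ 2 / 2 * |r (k i - k j)| + c j ^ 2 / 2 * |r (k i - k j)|) :=
        Finset.sum_le_sum fun i _ => Finset.sum_le_sum fun j _ => hterm i j
    _ = ∑ i, c i ^ 2 / 2 * ∑ j, |r (k i - k j)| + ∑ j, c j ^ 2 / 2 * ∑ i, |r (k i - k j)| := by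
        simp only [Finset.sum_add_distrib, Finset.mul_sum]
        congr 1
        exact Finset.sum_comm
    _ ≤ ∑ i, c i ^ 2 / 2 * ∑' m, |r m| + ∑ j, c j ^ 2 / 2 * ∑' m, |r m| := by
        gcongr with i _ j _
        · exact hrow i
        · exact hcol j
    _ = (∑' m, |r m|) * ∑ i, c i ^ 2 := by
        rw [← Finset.sum_mul, ← Finset.sum_div]; ring

lemma abs_sqrt_sub_one_le {a : ℝ} (ha : 0 ≤ a) : |√a - 1| ≤ |a - 1| := by
  have h : a - 1 = (√a - 1) * (√a + 1) := by nlinarith [Real.sq_sqrt ha]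
  rw [h, abs_mul]
  refine le_mul_of_one_le_right (abs_nonneg _) ?_
  rw [abs_of_nonneg (by positivity)]
  linarith [Real.sqrt_nonneg a]

/-- The variance of the coefficients at level `0`. -/
noncomputable def coeffVar (H : ℝ) : ℝ := 2 ^ (2 - 4 * H) * coeffAutocov H 0

/-- A bound on the operator norm of the covariance matrix of the coefficients at level `0`. -/
noncomputable def coeffCovBound (H : ℝ) : ℝ := 2 ^ (2 - 4 * H) * ∑' m : ℤ, |coeffAutocov H m|

lemma coeffVar_pos {H : ℝ} (hH : H ∈ Set.Ioo (0 : ℝ) 1) : 0 < coeffVar H :=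
  mul_pos (by positivity) (coeffAutocov_zero_pos hH)

lemma coeffCovBound_pos {H : ℝ} (hH : H ∈ Set.Ioo (0 : ℝ) 1) : 0 < coeffCovBound H := by
  refine mul_pos (by positivity) ((abs_pos.2 (coeffAutocov_zero_pos hH).ne').trans_le ?_)
  simpa using (summable_abs_coeffAutocov hH).le_tsum 0 fun _ _ => abs_nonneg _

section

variable {Ω : Type*} [MeasurableSpace Ω] {P : Measure Ω} [IsProbabilityMeasure P] {H : ℝ}
  {W : ℝ → Ω → ℝ}

lemma IsFBM.integral_sq_vartheta (hH : H ∈ Set.Ioo (0 : ℝ) 1) (hW : IsFBM P H W) {N k : ℕ}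
    (hk : k < 2 ^ N) :
    ∫ ω, (vartheta (fun t => ∫ s in (0 : ℝ)..t, W s ω) N k) ^ 2 ∂P =
      2 ^ ((N : ℝ) * (1 - 2 * H)) * coeffVar H := by
  have h := hW.map_sum_vartheta (ι := Unit) hH.1 (k := fun _ => k) (fun _ => hk) (fun _ => 1)
  simp only [Finset.univ_unique, Finset.sum_const, Finset.card_singleton, one_smul, one_mul,
    sub_self] at h
  rw [(integral_sq_of_map_eq_gaussianReal (hW.aemeasurable_vartheta hk) h).2, ← coeffVar,
    Real.coe_toNNReal _ (mul_nonneg (by positivity) (coeffVar_pos hH).le)]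

lemma IsFBM.measureReal_blockNormSq_le (hH : H ∈ Set.Ioo (0 : ℝ) 1) (hW : IsFBM P H W) {n i : ℕ}
    (hi : i < 2 ^ n) {δ : ℝ} (hδ : 0 ≤ δ) (hδ' : δ ≤ 1) :
    P.real {ω | δ ≤ |(2 : ℝ) ^ ((n : ℝ) * (2 * H - 3 / 2)) *
        √(blockNormSq (fun t => ∫ s in (0 : ℝ)..t, W s ω) n i) / √(coeffVar H) - 1|} ≤
      2 * Real.exp (-(δ ^ 2 * 2 ^ n * (coeffVar H / (16 * coeffCovBound H)))) := by
  have hk : ∀ j : Fin (2 ^ n), 2 ^ n * i + j < 2 ^ (2 * n) := fun j => by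
    have h1 : 2 ^ n * (i + 1) ≤ 2 ^ n * 2 ^ n := Nat.mul_le_mul_left _ hi
    rw [two_mul, pow_add]
    have := j.2
    linarith
  set q : ℝ := 2 ^ (((2 * n : ℕ) : ℝ) * (1 - 2 * H)) with hq
  have hq0 : 0 < q := by positivity
  have hv := coeffVar_pos hH
  have hS := coeffCovBound_pos hH
  have hcard : ((Fintype.card (Fin (2 ^ n)) : ℕ) : ℝ) = 2 ^ n := by simp
  set T : ℝ := 2 ^ n * (q * coeffVar H) with hT
  have hT0 : 0 < T := by positivity
  have key := measureReal_abs_sum_sq_sub_ge_le (P := P)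
    (X := fun (j : Fin (2 ^ n)) ω =>
      vartheta (fun t => ∫ s in (0 : ℝ)..t, W s ω) (2 * n) (2 ^ n * i + j))
    (fun j => hW.aemeasurable_vartheta (hk j)) (S := q * coeffCovBound H)
    (τ := q * coeffVar H) (by positivity)
    (fun c => by
      refine ⟨_, ?_, hW.map_sum_vartheta hH.1 hk c⟩
      have hinj : Function.Injective fun j : Fin (2 ^ n) => ((2 ^ n * i + j : ℕ) : ℤ) :=
        fun a b h => by simpa [Fin.ext_iff] using h
      have hb := sum_sum_mul_mul_sub_le (summable_abs_coeffAutocov hH) hinj c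
      rw [Real.coe_toNNReal', max_le_iff]
      refine ⟨?_, by positivity⟩
      calc _ = q * 2 ^ (2 - 4 * H) * ∑ a, ∑ b, c a * c b * coeffAutocov H
            ((((2 ^ n * i + (a : Fin (2 ^ n)) : ℕ) : ℤ) - ((2 ^ n * i + (b : Fin (2 ^ n)) : ℕ) : ℤ)
              : ℤ) : ℝ) := by
            simp only [Finset.mul_sum, Int.cast_sub, Int.cast_natCast]
            refine Finset.sum_congr rfl fun a _ => Finset.sum_congr rfl fun b _ => by ring
        _ ≤ q * 2 ^ (2 - 4 * H) * ((∑' m : ℤ, |coeffAutocov H m|) * ∑ a, c a ^ 2) := by gcongr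
        _ = _ := by rw [coeffCovBound]; ring)
    (fun j => hW.integral_sq_vartheta hH (hk j)) (t := δ * T) (by positivity)
    (by rw [hcard]; exact mul_le_of_le_one_left hT0.le hδ')
  rw [hcard, ← hT] at key
  have hexp : -(δ * T) ^ 2 / (16 * (q * coeffCovBound H) * T) =
      -(δ ^ 2 * 2 ^ n * (coeffVar H / (16 * coeffCovBound H))) := by
    rw [hT]; field_simp
  rw [hexp] at key
  refine (measureReal_mono fun ω hω => ?_).trans key
  have hblock : ∑ j : Fin (2 ^ n),
      vartheta (fun t => ∫ s in (0 : ℝ)..t, W s ω) (2 * n) (2 ^ n * i + j) ^ 2 =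
      blockNormSq (fun t => ∫ s in (0 : ℝ)..t, W s ω) n i :=
    Fin.sum_univ_eq_sum_range (fun j =>
      vartheta (fun t => ∫ s in (0 : ℝ)..t, W s ω) (2 * n) (2 ^ n * i + j) ^ 2) _
  simp only [Set.mem_ofPred_eq, hblock] at hω ⊢
  set B := blockNormSq (fun t => ∫ s in (0 : ℝ)..t, W s ω) n i
  have hB : 0 ≤ B := Finset.sum_nonneg fun _ _ => sq_nonneg _
  have hscale : (2 : ℝ) ^ ((n : ℝ) * (2 * H - 3 / 2)) * √B / √(coeffVar H) = √(B / T) := by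
    have h2 : (2 : ℝ) ^ ((n : ℝ) * (2 * H - 3 / 2)) = √((2 ^ n * q)⁻¹) := by
      rw [eq_comm, Real.sqrt_eq_iff_mul_self_eq (by positivity) (by positivity),
        ← Real.rpow_natCast 2 n, hq, ← Real.rpow_add two_pos, ← Real.rpow_add two_pos,
        ← Real.rpow_neg two_pos.le]
      congr 1
      push_cast
      ring
    rw [h2, ← Real.sqrt_mul (by positivity), ← Real.sqrt_div (by positivity), hT]
    congr 1
    field_simp
  rw [hscale] at hω
  have h3 := hω.trans (abs_sqrt_sub_one_le (div_nonneg hB hT0.le))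
  rwa [div_sub_one hT0.ne', abs_div, abs_of_pos hT0, le_div_iff₀ hT0] at h3

end

lemma deltaSeq_nonneg {c : ℝ} (hc : 0 ≤ c) (n : ℕ) : 0 ≤ deltaSeq c n := by
  unfold deltaSeq
  positivity

lemma deltaSeq_sq_mul (c : ℝ) (n : ℕ) :
    deltaSeq c n ^ 2 * 2 ^ n = c ^ 2 * (n * Real.log 2 + 2 * Real.log n) := by
  have h0 : 0 ≤ (n : ℝ) * Real.log 2 + 2 * Real.log n := by
    have := Real.log_natCast_nonneg n
    positivity
  have h1 : ((2 : ℝ) ^ (-(n : ℝ) / 2)) ^ 2 * 2 ^ n = 1 := by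
    rw [← Real.rpow_natCast _ 2, ← Real.rpow_mul two_pos.le, ← Real.rpow_natCast 2 n,
      ← Real.rpow_add two_pos]
    simp
  rw [deltaSeq, mul_pow, mul_pow, Real.sq_sqrt h0]
  linear_combination c ^ 2 * (n * Real.log 2 + 2 * Real.log n) * h1

lemma eventually_deltaSeq_le_one (c : ℝ) : ∀ᶠ n in atTop, deltaSeq c n ≤ 1 := by
  have h := (tendsto_self_mul_const_pow_of_lt_one (r := (1 / 2 : ℝ)) (by norm_num)
    (by norm_num)).const_mul (3 * c ^ 2)
  rw [mul_zero] at h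
  filter_upwards [h.eventually_le_const one_pos] with n hn
  have hpow : (0 : ℝ) < 2 ^ n := by positivity
  have hlog : (n : ℝ) * Real.log 2 + 2 * Real.log n ≤ 3 * n := by
    have h2 : (n : ℝ) * Real.log 2 ≤ n :=
      mul_le_of_le_one_right n.cast_nonneg (by linarith [Real.log_two_lt_d9])
    linarith [Real.log_le_self n.cast_nonneg (x := (n : ℝ))]
  have hsq : deltaSeq c n ^ 2 ≤ 1 := by
    rw [← mul_le_mul_iff_left₀ hpow, deltaSeq_sq_mul, one_mul]
    calc c ^ 2 * (n * Real.log 2 + 2 * Real.log n) ≤ c ^ 2 * (3 * n) := by gcongr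
      _ = 3 * c ^ 2 * (n * (1 / 2) ^ n) * 2 ^ n := by rw [one_div, inv_pow]; field_simp
      _ ≤ 1 * 2 ^ n := by gcongr
      _ = 2 ^ n := one_mul _
  exact (abs_le.1 ((sq_le_one_iff_abs_le_one _).1 hsq)).2

theorem stmt2 {Ω : Type*} [MeasurableSpace Ω] (P : Measure Ω) [IsProbabilityMeasure P]
    (H : ℝ) (hH : H ∈ Set.Ioo (0 : ℝ) 1)
    (W : ℝ → Ω → ℝ) (hW : IsFBM P H W)
    (tauH : ℝ)
    (htau : tauH = ∫ ω, (vartheta (fun t => ∫ s in (0 : ℝ)..t, W s ω) 0 0) ^ 2 ∂P) :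
    ∃ cH : ℝ, 0 < cH ∧ ∀ᵐ ω ∂P,
      Filter.atTop.limsup (fun n : ℕ =>
        (deltaSeq cH n)⁻¹ *
          ⨆ i : Fin (2 ^ n),
            |(2 : ℝ) ^ ((n : ℝ) * (2 * H - 3 / 2)) *
                Real.sqrt (blockNormSq (fun t => ∫ s in (0 : ℝ)..t, W s ω) n i) /
              Real.sqrt tauH - 1|) ≤ 1 := by
  have htau' : tauH = coeffVar H := by
    rw [htau, hW.integral_sq_vartheta hH (by norm_num)]
    simp
  have hv := coeffVar_pos hH
  have hS := coeffCovBound_pos hH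
  have hr : 0 < 16 * coeffCovBound H / coeffVar H := by positivity
  set cH : ℝ := √(16 * coeffCovBound H / coeffVar H) with hcH
  have hcH0 : 0 < cH := Real.sqrt_pos.2 hr
  have hexp : ∀ n : ℕ, 1 ≤ n →
      Real.exp (-(deltaSeq cH n ^ 2 * 2 ^ n * (coeffVar H / (16 * coeffCovBound H)))) =
        (2 ^ n * (n : ℝ) ^ 2)⁻¹ := fun n hn => by
    have hn0 : (0 : ℝ) < n := by exact_mod_cast hn
    have : deltaSeq cH n ^ 2 * 2 ^ n * (coeffVar H / (16 * coeffCovBound H)) =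
        Real.log (2 ^ n * (n : ℝ) ^ 2) := by
      rw [deltaSeq_sq_mul, hcH, Real.sq_sqrt hr.le, Real.log_mul (by positivity) (by positivity),
        Real.log_pow, Real.log_pow]
      field_simp
      push_cast
      ring
    rw [this, Real.exp_neg, Real.exp_log (by positivity)]
  subst htau'
  refine ⟨cH, hcH0, ?_⟩
  let dev : ℕ → ℕ → Ω → ℝ := fun n i ω => |(2 : ℝ) ^ ((n : ℝ) * (2 * H - 3 / 2)) *
    √(blockNormSq (fun t => ∫ s in (0 : ℝ)..t, W s ω) n i) / √(coeffVar H) - 1|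
  let bad : ℕ → Set Ω := fun n => ⋃ i : Fin (2 ^ n), {ω | deltaSeq cH n ≤ dev n i ω}
  have hbad : ∀ᶠ n in atTop, ‖P.real (bad n)‖ ≤ 2 * (1 / (n : ℝ) ^ 2) := by
    filter_upwards [eventually_deltaSeq_le_one cH, eventually_ge_atTop 1] with n hn hn1
    have hn0 : (0 : ℝ) < n := by exact_mod_cast hn1
    rw [Real.norm_of_nonneg measureReal_nonneg]
    calc P.real (bad n) ≤ ∑ i : Fin (2 ^ n), P.real {ω | deltaSeq cH n ≤ dev n i ω} :=
          measureReal_iUnion_fintype_le _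
      _ ≤ ∑ _i : Fin (2 ^ n), 2 * (2 ^ n * (n : ℝ) ^ 2)⁻¹ := Finset.sum_le_sum fun i _ => by
          rw [← hexp n hn1]
          exact hW.measureReal_blockNormSq_le hH i.2 (deltaSeq_nonneg hcH0.le n) hn
      _ = 2 * (1 / (n : ℝ) ^ 2) := by
          rw [Finset.sum_const, Finset.card_univ, Fintype.card_fin, nsmul_eq_mul]
          push_cast
          field_simp
  have hsum : Summable fun n => P.real (bad n) :=
    .of_norm_bounded_eventually_nat
      ((Real.summable_one_div_nat_pow.2 one_lt_two).mul_left 2) hbad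
  have htop : ∑' n, P (bad n) ≠ ⊤ := by
    simpa [ofReal_measureReal] using hsum.tsum_ofReal_ne_top
  filter_upwards [ae_eventually_notMem htop] with ω hω
  refine limsup_le_of_le (isCoboundedUnder_le_of_le atTop (x := 0) fun n =>
    mul_nonneg (inv_nonneg.2 (deltaSeq_nonneg hcH0.le n)) (Real.iSup_nonneg fun _ => abs_nonneg _)) ?_
  filter_upwards [hω] with n hn
  simp only [bad, Set.mem_iUnion, Set.mem_ofPred_eq, not_exists, not_le] at hn
  calc _ ≤ (deltaSeq cH n)⁻¹ * deltaSeq cH n := by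
        gcongr
        · exact inv_nonneg.2 (deltaSeq_nonneg hcH0.le n)
        · exact ciSup_le fun i => (hn i).le
    _ ≤ 1 := inv_mul_le_one
end

section
/- Let H ∈ (0,1), let W^H be a fractional Brownian motion with Hurst parameter H, and let Y_t := ∫₀ᵗ W^H_s ds. Then for every n ∈ ℕ, every 0 ≤ i ≤ 2^n − 1, and all 0 ≤ j, k ≤ 2^n − 1, one has E[ ϑ^Y_{2n, 2^n i + j} · ϑ^Y_{2n, 2^n i + k} ] = 2^{(1−2H)n} · E[ ϑ^Y_{n, j} · ϑ^Y_{n, k} ]; that is, the covariance matrix of each block ϑ̄^Y_{2n,i} equals 2^{(1−2H)n} times the covariance matrix of ϑ̄^Y_n. -/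
open MeasureTheory ProbabilityTheory Filter

/-- Polarization of second moments. -/
theorem integral_mul_eq_half_sq {Ω : Type*} [MeasurableSpace Ω] {P : Measure Ω} {X Y : Ω → ℝ}
    (hX : MemLp X 2 P) (hY : MemLp Y 2 P) :
    ∫ ω, X ω * Y ω ∂P =
      (∫ ω, X ω ^ 2 ∂P + ∫ ω, Y ω ^ 2 ∂P - ∫ ω, (X ω - Y ω) ^ 2 ∂P) / 2 := by
  have hXY : Integrable (fun ω => X ω ^ 2 + Y ω ^ 2) P := hX.integrable_sq.add hY.integrable_sq
  have hsub : Integrable (fun ω => (X ω - Y ω) ^ 2) P := (hX.sub hY).integrable_sq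
  rw [← integral_add hX.integrable_sq hY.integrable_sq, ← integral_sub hXY hsub, ← integral_div]
  congr 1 with ω
  ring

/-- The second moment of a product of two primitives of a continuous process with bounded second
moments is the double integral of its covariance kernel. -/
theorem integrable_and_integral_mul_primitive {Ω : Type*} [MeasurableSpace Ω] {P : Measure Ω}
    [IsProbabilityMeasure P] {X : ℝ → Ω → ℝ} (hm : ∀ t, Measurable (X t))
    (hc : ∀ᵐ ω ∂P, ContinuousOn (fun t => X t ω) (Set.Icc 0 1)) {B : ℝ}
    (h2 : ∀ t ∈ Set.Icc (0 : ℝ) 1, MemLp (X t) 2 P)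
    (hB : ∀ t ∈ Set.Icc (0 : ℝ) 1, ∫ ω, X t ω ^ 2 ∂P ≤ B)
    {p q : ℝ} (hp : p ∈ Set.Icc (0 : ℝ) 1) (hq : q ∈ Set.Icc (0 : ℝ) 1) :
    Integrable (fun ω => (∫ s in (0 : ℝ)..p, X s ω) * ∫ t in (0 : ℝ)..q, X t ω) P ∧
      ∫ ω, (∫ s in (0 : ℝ)..p, X s ω) * (∫ t in (0 : ℝ)..q, X t ω) ∂P =
        ∫ z in Set.Ioc 0 p ×ˢ Set.Ioc 0 q, ∫ ω, X z.1 ω * X z.2 ω ∂P := by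
  obtain ⟨G, hG, hGm, hGc⟩ := hc.exists_measurable_mem
  -- `Z` is a version of the process all of whose paths are continuous.
  let π : ℝ → ℝ := fun s => Set.projIcc (0 : ℝ) 1 zero_le_one s
  have hπ : ∀ s, π s ∈ Set.Icc (0 : ℝ) 1 := fun s => Subtype.prop _
  have hπc : Continuous π := continuous_subtype_val.comp continuous_projIcc
  have hπe : ∀ s ∈ Set.Icc (0 : ℝ) 1, π s = s := fun s hs => by
    simp [π, Set.projIcc_of_mem zero_le_one hs]
  let Z : ℝ → Ω → ℝ := fun s => G.indicator (X (π s))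
  have hZX : ∀ s, Z s =ᵐ[P] X (π s) := fun s => by
    filter_upwards [hG] with ω hω
    simp [Z, hω]
  have hZ2 : ∀ s, MemLp (Z s) 2 P := fun s => (h2 _ (hπ s)).ae_eq (hZX s).symm
  have hZB : ∀ s, ∫ ω, Z s ω ^ 2 ∂P ≤ B := fun s => by
    refine (integral_congr_ae ?_).trans_le (hB _ (hπ s))
    filter_upwards [hZX s] with ω hω
    simp [hω]
  have hZm : StronglyMeasurable (Function.uncurry Z) := by
    refine stronglyMeasurable_uncurry_of_continuous_of_stronglyMeasurable (fun ω => ?_)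
      fun s => ((hm _).indicator hGm).stronglyMeasurable
    by_cases hω : ω ∈ G
    · simpa [Z, hω, Function.comp_def] using (hGc ω hω).comp_continuous hπc hπ
    · simpa [Z, hω] using continuous_const
  let ν : Measure (ℝ × ℝ) := (volume.restrict (Set.Ioc 0 p)).prod (volume.restrict (Set.Ioc 0 q))
  let F : ℝ × ℝ → Ω → ℝ := fun z ω => Z z.1 ω * Z z.2 ω
  have hFm : StronglyMeasurable (Function.uncurry F) :=
    (hZm.comp_measurable (by fun_prop : Measurable fun x : (ℝ × ℝ) × Ω => (x.1.1, x.2))).mul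
      (hZm.comp_measurable (by fun_prop : Measurable fun x : (ℝ × ℝ) × Ω => (x.1.2, x.2)))
  have hF : Integrable (Function.uncurry F) (ν.prod P) := by
    rw [integrable_prod_iff hFm.aestronglyMeasurable]
    refine ⟨ae_of_all _ fun z => (hZ2 z.1).integrable_mul (hZ2 z.2), ?_⟩
    refine Integrable.of_bound (C := B) ?_ (ae_of_all _ fun z => ?_)
    · exact (StronglyMeasurable.integral_prod_right
        (f := fun z ω => ‖F z ω‖) hFm.norm).aestronglyMeasurable
    · rw [Real.norm_of_nonneg (integral_nonneg fun ω => norm_nonneg _)]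
      have hsum : Integrable (fun ω => (Z z.1 ω ^ 2 + Z z.2 ω ^ 2) / 2) P :=
        ((hZ2 z.1).integrable_sq.add (hZ2 z.2).integrable_sq).div_const 2
      calc ∫ ω, ‖F z ω‖ ∂P ≤ ∫ ω, (Z z.1 ω ^ 2 + Z z.2 ω ^ 2) / 2 ∂P := by
            refine integral_mono ((hZ2 z.1).integrable_mul (hZ2 z.2)).norm hsum fun ω => ?_
            simp only [F, norm_mul, Real.norm_eq_abs]
            nlinarith [sq_nonneg (|Z z.1 ω| - |Z z.2 ω|), sq_abs (Z z.1 ω), sq_abs (Z z.2 ω)]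
        _ ≤ B := by
            rw [integral_div, integral_add (hZ2 z.1).integrable_sq (hZ2 z.2).integrable_sq]
            linarith [hZB z.1, hZB z.2]
  have hprim : ∀ ω ∈ G, ∀ r ∈ Set.Icc (0 : ℝ) 1,
      ∫ s in Set.Ioc 0 r, Z s ω = ∫ s in (0 : ℝ)..r, X s ω := fun ω hω r hr => by
    rw [intervalIntegral.integral_of_le hr.1]
    refine setIntegral_congr_fun measurableSet_Ioc fun s hs => ?_
    simp [Z, hω, hπe s ⟨hs.1.le, hs.2.trans hr.2⟩]
  have hprod : (fun ω => ∫ z, F z ω ∂ν) =ᵐ[P]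
      fun ω => (∫ s in (0 : ℝ)..p, X s ω) * ∫ t in (0 : ℝ)..q, X t ω := by
    filter_upwards [hG] with ω hω
    rw [← hprim ω hω p hp, ← hprim ω hω q hq]
    exact integral_prod_mul (fun s => Z s ω) (fun t => Z t ω)
  refine ⟨hF.integral_prod_right.congr hprod, ?_⟩
  rw [← integral_congr_ae hprod, ← integral_integral_swap hF]
  simp only [ν]
  rw [Measure.prod_restrict]
  refine setIntegral_congr_fun (measurableSet_Ioc.prod measurableSet_Ioc) fun z hz => ?_
  refine integral_congr_ae ?_
  filter_upwards [hZX z.1, hZX z.2] with ω h₁ h₂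
  simp only [F, h₁, h₂]
  rw [hπe _ ⟨hz.1.1.le, hz.1.2.trans hp.2⟩, hπe _ ⟨hz.2.1.le, hz.2.2.trans hq.2⟩]

theorem vartheta_eq_sum (f : ℝ → ℝ) (n k : ℕ) :
    vartheta f n k = ∑ r : Fin 4, (2 : ℝ) ^ ((3 * (n : ℝ)) / 2 + 3) * (![1, -2, 2, -1] : _ → ℝ) r *
      f ((4 * k + (![0, 1, 3, 4] : _ → ℝ) r) / 2 ^ (n + 2)) := by
  simp [vartheta, Fin.sum_univ_four]
  ring

theorem dyadic_mem_Icc {n k : ℕ} (hk : k < 2 ^ n) (r : Fin 4) :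
    (4 * k + (![0, 1, 3, 4] : _ → ℝ) r) / 2 ^ (n + 2) ∈ Set.Icc (0 : ℝ) 1 := by
  have hk' : (k : ℝ) + 1 ≤ 2 ^ n := by exact_mod_cast hk
  have hr : 0 ≤ (![0, 1, 3, 4] : _ → ℝ) r ∧ (![0, 1, 3, 4] : _ → ℝ) r ≤ 4 := by
    fin_cases r <;> norm_num
  refine ⟨div_nonneg (by linarith [hr.1, k.cast_nonneg (α := ℝ)]) (by positivity), ?_⟩
  rw [div_le_one (by positivity), pow_add]
  linarith [hr.2]

/-- If the covariance kernels of two processes are proportional, then so are the covariances of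
the coefficients of their primitives. -/
theorem integral_vartheta_mul_vartheta_of_cov {Ω : Type*} [MeasurableSpace Ω] {P : Measure Ω}
    [IsProbabilityMeasure P] {X X' : ℝ → Ω → ℝ} {B B' a : ℝ}
    (hm : ∀ t, Measurable (X t))
    (hc : ∀ᵐ ω ∂P, ContinuousOn (fun t => X t ω) (Set.Icc 0 1))
    (h2 : ∀ t ∈ Set.Icc (0 : ℝ) 1, MemLp (X t) 2 P)
    (hB : ∀ t ∈ Set.Icc (0 : ℝ) 1, ∫ ω, X t ω ^ 2 ∂P ≤ B)
    (hm' : ∀ t, Measurable (X' t))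
    (hc' : ∀ᵐ ω ∂P, ContinuousOn (fun t => X' t ω) (Set.Icc 0 1))
    (h2' : ∀ t ∈ Set.Icc (0 : ℝ) 1, MemLp (X' t) 2 P)
    (hB' : ∀ t ∈ Set.Icc (0 : ℝ) 1, ∫ ω, X' t ω ^ 2 ∂P ≤ B')
    (hcov : ∀ s ∈ Set.Icc (0 : ℝ) 1, ∀ t ∈ Set.Icc (0 : ℝ) 1,
      ∫ ω, X' s ω * X' t ω ∂P = a * ∫ ω, X s ω * X t ω ∂P)
    {n j k : ℕ} (hj : j < 2 ^ n) (hk : k < 2 ^ n) :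
    ∫ ω, vartheta (fun t => ∫ s in (0 : ℝ)..t, X' s ω) n j *
        vartheta (fun t => ∫ s in (0 : ℝ)..t, X' s ω) n k ∂P =
      a * ∫ ω, vartheta (fun t => ∫ s in (0 : ℝ)..t, X s ω) n j *
        vartheta (fun t => ∫ s in (0 : ℝ)..t, X s ω) n k ∂P := by
  simp only [vartheta_eq_sum, Finset.sum_mul_sum, mul_mul_mul_comm _ (intervalIntegral _ _ _ _)]
  have key := fun r r' => integrable_and_integral_mul_primitive hm hc h2 hB
    (dyadic_mem_Icc hj r) (dyadic_mem_Icc hk r')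
  have key' := fun r r' => integrable_and_integral_mul_primitive hm' hc' h2' hB'
    (dyadic_mem_Icc hj r) (dyadic_mem_Icc hk r')
  rw [integral_finsetSum _ fun r _ => integrable_finsetSum _ fun r' _ =>
      (key' r r').1.const_mul _,
    integral_finsetSum _ fun r _ => integrable_finsetSum _ fun r' _ =>
      (key r r').1.const_mul _, Finset.mul_sum]
  refine Finset.sum_congr rfl fun r _ => ?_
  rw [integral_finsetSum _ fun r' _ => (key' r r').1.const_mul _,
    integral_finsetSum _ fun r' _ => (key r r').1.const_mul _, Finset.mul_sum]
  refine Finset.sum_congr rfl fun r' _ => ?_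
  rw [integral_const_mul, integral_const_mul, (key r r').2, (key' r r').2,
    mul_left_comm a, ← integral_const_mul a]
  congr 1
  refine setIntegral_congr_fun (measurableSet_Ioc.prod measurableSet_Ioc) fun z hz => ?_
  exact hcov _ ⟨hz.1.1.le, hz.1.2.trans (dyadic_mem_Icc hj r).2⟩
    _ ⟨hz.2.1.le, hz.2.2.trans (dyadic_mem_Icc hk r').2⟩

/-- The affine map sending `[0,1]` onto the `i`-th dyadic interval of level `n` takes
values in `[0,1]`. -/
theorem dyadic_affine_mem_Icc {n i : ℕ} (hi : i < 2 ^ n) {s : ℝ} (hs : s ∈ Set.Icc (0 : ℝ) 1) :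
    (i : ℝ) / 2 ^ n + (2 ^ n)⁻¹ * s ∈ Set.Icc (0 : ℝ) 1 := by
  have hi' : (i : ℝ) + 1 ≤ 2 ^ n := by exact_mod_cast hi
  have h0 := hs.1
  refine ⟨by positivity, ?_⟩
  rw [inv_mul_eq_div, ← add_div, div_le_one (by positivity)]
  linarith [hs.2]

/-- The coefficients of a primitive in a dyadic block are, up to a factor, those of the primitive
of the rescaled increments of the integrand. -/
theorem vartheta_primitive_block {f : ℝ → ℝ} (hf : ContinuousOn f (Set.Icc 0 1))
    {n i j : ℕ} (hi : i < 2 ^ n) (hj : j < 2 ^ n) :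
    vartheta (fun t => ∫ s in (0 : ℝ)..t, f s) (2 * n) (2 ^ n * i + j) =
      (2 : ℝ) ^ (3 * (n : ℝ) / 2) * (2 ^ n)⁻¹ *
        vartheta (fun t => ∫ s in (0 : ℝ)..t,
          (f (i / 2 ^ n + (2 ^ n)⁻¹ * s) - f (i / 2 ^ n))) n j := by
  have hsub : ∀ {a b : ℝ}, a ∈ Set.Icc (0 : ℝ) 1 → b ∈ Set.Icc (0 : ℝ) 1 →
      Set.uIcc a b ⊆ Set.Icc 0 1 := fun ha hb => Set.uIcc_subset_Icc ha hb
  have h0 : (0 : ℝ) ∈ Set.Icc (0 : ℝ) 1 := by simp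
  have hx : (i : ℝ) / 2 ^ n ∈ Set.Icc (0 : ℝ) 1 := by simpa using dyadic_affine_mem_Icc hi h0
  have hg : ContinuousOn (fun s => f (i / 2 ^ n + (2 ^ n)⁻¹ * s)) (Set.Icc 0 1) :=
    hf.comp (by fun_prop) fun s hs => dyadic_affine_mem_Icc hi hs
  have key : ∀ p ∈ Set.Icc (0 : ℝ) 1, ∫ s in (0 : ℝ)..(i / 2 ^ n + (2 ^ n)⁻¹ * p), f s =
      (∫ s in (0 : ℝ)..(i / 2 ^ n), f s) + (2 ^ n)⁻¹ * ((∫ s in (0 : ℝ)..p,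
        (f (i / 2 ^ n + (2 ^ n)⁻¹ * s) - f (i / 2 ^ n))) + p * f (i / 2 ^ n)) := by
    intro p hp
    rw [← intervalIntegral.integral_add_adjacent_intervals
        (hf.mono (hsub h0 hx)).intervalIntegrable
        (hf.mono (hsub hx (dyadic_affine_mem_Icc hi hp))).intervalIntegrable,
      intervalIntegral.integral_sub (hg.mono (hsub h0 hp)).intervalIntegrable
        intervalIntegrable_const,
      intervalIntegral.integral_comp_add_mul f (by positivity)]
    simp
  have hpt : ∀ r : ℝ, (4 * ((2 ^ n * i + j : ℕ) : ℝ) + r) / 2 ^ (2 * n + 2) =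
      i / 2 ^ n + (2 ^ n)⁻¹ * ((4 * j + r) / 2 ^ (n + 2)) := by
    intro r
    push_cast
    field_simp
    ring
  have hpow : (2 : ℝ) ^ ((3 * ((2 * n : ℕ) : ℝ)) / 2 + 3) =
      (2 : ℝ) ^ (3 * (n : ℝ) / 2) * (2 : ℝ) ^ ((3 * (n : ℝ)) / 2 + 3) := by
    rw [← Real.rpow_add two_pos]
    push_cast
    ring_nf
  rw [vartheta_eq_sum, vartheta_eq_sum]
  simp only [hpt, key _ (dyadic_mem_Icc hj _), hpow]
  simp only [Fin.sum_univ_four, Matrix.cons_val]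
  ring

theorem IsFBM.memLp_and_integral_sq {Ω : Type*} [MeasurableSpace Ω] {P : Measure Ω}
    {H : ℝ} {W : ℝ → Ω → ℝ} (hW : IsFBM P H W) {m : ℕ} (t c : Fin m → ℝ)
    (ht : ∀ i, t i ∈ Set.Icc (0 : ℝ) 1)
    (hv : 0 ≤ ∑ i, ∑ j, c i * c j * fbmCov H (t i) (t j)) :
    MemLp (fun ω => ∑ i, c i * W (t i) ω) 2 P ∧
      ∫ ω, (∑ i, c i * W (t i) ω) ^ 2 ∂P = ∑ i, ∑ j, c i * c j * fbmCov H (t i) (t j) := by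
  have hmap := hW.2.2 m t c ht
  have hmeas : Measurable fun ω => ∑ i, c i * W (t i) ω :=
    Finset.measurable_sum _ fun i _ => (hW.1 (t i)).const_mul (c i)
  constructor
  · have h := memLp_id_gaussianReal (μ := 0)
      (v := Real.toNNReal (∑ i, ∑ j, c i * c j * fbmCov H (t i) (t j))) 2
    rw [← hmap, memLp_map_measure_iff aestronglyMeasurable_id hmeas.aemeasurable] at h
    simpa using h
  · have h := variance_fun_id_gaussianReal (μ := 0)
      (v := Real.toNNReal (∑ i, ∑ j, c i * c j * fbmCov H (t i) (t j)))
    rw [variance_of_integral_eq_zero (by fun_prop) integral_id_gaussianReal, ← hmap,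
      integral_map hmeas.aemeasurable (by fun_prop), Real.coe_toNNReal _ hv] at h
    exact h

theorem IsFBM.memLp_and_integral_sq_eval {Ω : Type*} [MeasurableSpace Ω] {P : Measure Ω}
    {H : ℝ} (hH : 0 < H) {W : ℝ → Ω → ℝ} (hW : IsFBM P H W) {t : ℝ}
    (ht : t ∈ Set.Icc (0 : ℝ) 1) :
    MemLp (W t) 2 P ∧ ∫ ω, W t ω ^ 2 ∂P = t ^ (2 * H) := by
  have hv : fbmCov H t t = t ^ (2 * H) := by
    simp [fbmCov, Real.zero_rpow (by positivity : 2 * H ≠ 0)]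
  have h := hW.memLp_and_integral_sq (m := 1) (fun _ => t) (fun _ => 1) (fun _ => ht)
    (by simpa [hv] using Real.rpow_nonneg ht.1 _)
  simpa [hv] using h

theorem IsFBM.integral_sq_sub {Ω : Type*} [MeasurableSpace Ω] {P : Measure Ω}
    {H : ℝ} (hH : 0 < H) {W : ℝ → Ω → ℝ} (hW : IsFBM P H W) {s t : ℝ}
    (hs : s ∈ Set.Icc (0 : ℝ) 1) (ht : t ∈ Set.Icc (0 : ℝ) 1) :
    ∫ ω, (W s ω - W t ω) ^ 2 ∂P = |s - t| ^ (2 * H) := by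
  have hv : ∑ i, ∑ j, (![1, -1] : Fin 2 → ℝ) i * (![1, -1] : Fin 2 → ℝ) j *
      fbmCov H ((![s, t] : Fin 2 → ℝ) i) ((![s, t] : Fin 2 → ℝ) j) = |s - t| ^ (2 * H) := by
    simp [fbmCov, Real.zero_rpow (by positivity : 2 * H ≠ 0), Fin.sum_univ_two, abs_sub_comm t s]
    ring
  have h := (hW.memLp_and_integral_sq (m := 2) ![s, t] ![1, -1]
    (fun i => by fin_cases i <;> simpa) (by rw [hv]; positivity)).2
  rw [hv] at h
  simpa [Fin.sum_univ_two, ← sub_eq_add_neg] using h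

/-- Self-similarity of the blocks: the covariance matrix of each block `ϑ̄^Y_{2n,i}`
equals `2^{(1-2H)n}` times the covariance matrix of `ϑ̄^Y_n`, where `Y_t = ∫₀ᵗ W^H_s ds`. -/
theorem stmt4 {Ω : Type*} [MeasurableSpace Ω] (P : Measure Ω) [IsProbabilityMeasure P]
    (H : ℝ) (hH : H ∈ Set.Ioo (0 : ℝ) 1)
    (W : ℝ → Ω → ℝ) (hW : IsFBM P H W)
    (n i j k : ℕ) (hi : i < 2 ^ n) (hj : j < 2 ^ n) (hk : k < 2 ^ n) :
    ∫ ω, (vartheta (fun t => ∫ s in (0 : ℝ)..t, W s ω) (2 * n) (2 ^ n * i + j) *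
        vartheta (fun t => ∫ s in (0 : ℝ)..t, W s ω) (2 * n) (2 ^ n * i + k)) ∂P =
      (2 : ℝ) ^ ((1 - 2 * H) * (n : ℝ)) *
        ∫ ω, (vartheta (fun t => ∫ s in (0 : ℝ)..t, W s ω) n j *
          vartheta (fun t => ∫ s in (0 : ℝ)..t, W s ω) n k) ∂P := by
  have hH0 := hH.1
  let x : ℝ := i / 2 ^ n
  let V : ℝ → Ω → ℝ := fun s ω => W (x + (2 ^ n)⁻¹ * s) ω - W x ω
  have hA : ∀ s ∈ Set.Icc (0 : ℝ) 1, x + (2 ^ n)⁻¹ * s ∈ Set.Icc (0 : ℝ) 1 :=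
    fun s hs => dyadic_affine_mem_Icc hi hs
  have hx : x ∈ Set.Icc (0 : ℝ) 1 := by simpa using hA 0 (by simp)
  have hW2 : ∀ t ∈ Set.Icc (0 : ℝ) 1, MemLp (W t) 2 P :=
    fun t ht => (hW.memLp_and_integral_sq_eval hH0 ht).1
  have hWsq : ∀ t ∈ Set.Icc (0 : ℝ) 1, ∫ ω, W t ω ^ 2 ∂P = t ^ (2 * H) :=
    fun t ht => (hW.memLp_and_integral_sq_eval hH0 ht).2
  have hV2 : ∀ t ∈ Set.Icc (0 : ℝ) 1, MemLp (V t) 2 P :=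
    fun t ht => (hW2 _ (hA t ht)).sub (hW2 x hx)
  set a : ℝ := ((2 ^ n)⁻¹ : ℝ) ^ (2 * H) with ha
  have hVsq : ∀ t ∈ Set.Icc (0 : ℝ) 1, ∫ ω, V t ω ^ 2 ∂P = a * t ^ (2 * H) := by
    intro t ht
    have ht0 := ht.1
    simp only [V]
    rw [hW.integral_sq_sub hH0 (hA t ht) hx, add_sub_cancel_left, abs_of_nonneg (by positivity),
      Real.mul_rpow (by positivity) ht0]
  have hcov : ∀ s ∈ Set.Icc (0 : ℝ) 1, ∀ t ∈ Set.Icc (0 : ℝ) 1,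
      ∫ ω, V s ω * V t ω ∂P = a * ∫ ω, W s ω * W t ω ∂P := by
    intro s hs t ht
    rw [integral_mul_eq_half_sq (hV2 s hs) (hV2 t ht),
      integral_mul_eq_half_sq (hW2 s hs) (hW2 t ht),
      hVsq s hs, hVsq t ht, hWsq s hs, hWsq t ht, hW.integral_sq_sub hH0 hs ht]
    simp only [V, sub_sub_sub_cancel_right]
    rw [hW.integral_sq_sub hH0 (hA s hs) (hA t ht), add_sub_add_left_eq_sub, ← mul_sub, abs_mul,
      abs_of_nonneg (by positivity : (0 : ℝ) ≤ (2 ^ n)⁻¹),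
      Real.mul_rpow (by positivity) (abs_nonneg _)]
    ring
  have hblock := integral_vartheta_mul_vartheta_of_cov (X' := V) (B := 1) (B' := a) hW.1 hW.2.1 hW2
    (fun t ht => (hWsq t ht).trans_le (Real.rpow_le_one ht.1 ht.2 (by positivity)))
    (fun t => (hW.1 _).sub (hW.1 _))
    (hW.2.1.mono fun ω hω => (hω.comp (by fun_prop) fun s hs => hA s hs).sub continuousOn_const)
    hV2
    (fun t ht => (hVsq t ht).trans_le (mul_le_of_le_one_right (by positivity)
      (Real.rpow_le_one ht.1 ht.2 (by positivity))))
    hcov hj hk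
  have hscale : (2 : ℝ) ^ ((1 - 2 * H) * (n : ℝ)) =
      ((2 : ℝ) ^ (3 * (n : ℝ) / 2) * (2 ^ n)⁻¹) ^ 2 * a := by
    rw [ha, ← Real.rpow_natCast 2 n, ← Real.rpow_neg zero_le_two, ← Real.rpow_mul zero_le_two,
      ← Real.rpow_add two_pos, ← Real.rpow_natCast _ 2, ← Real.rpow_mul zero_le_two,
      ← Real.rpow_add two_pos]
    push_cast
    ring_nf
  rw [hscale, mul_assoc, ← hblock, ← integral_const_mul]
  refine integral_congr_ae ?_
  filter_upwards [hW.2.1] with ω hω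
  rw [vartheta_primitive_block hω hi hj, vartheta_primitive_block hω hi hk]
  simp only [V, x]
  ring
end
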